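/- arXiv:2505.19285 — 5 statements merged into one kernel-verified Lean document; each statement's English description precedes it below -/
import Mathlib

section
/- Let X be a tree, let x and y be vertices with d(x,y) = δ, and let α, β ≥ 0 be integers. Then: (1) if α + β < δ, the intersection B_α(x) ∩ B_β(y) is empty; (2) if |α − β| ≤ δ ≤ α + β and α + β − δ is even, then B_α(x) ∩ B_β(y) = B_{(α+β−δ)/2}(c), where c is the vertex on the geodesic from x to y with d(x,c) = (α − β + δ)/2; (3) if δ ≤ |α − β|, then B_α(x) ∩ B_β(y) equals B_β(y) when α ≥ β and equals B_α(x) when α ≤ β. -/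
namespace SimpleGraph

variable {V : Type*} {G : SimpleGraph V}

/-- A vertex on a shortest walk splits the distance between its endpoints. -/
lemma Walk.dist_add_dist_of_mem_support {u v c : V} {p : G.Walk u v}
    (hp : p.length = G.dist u v) (hc : c ∈ p.support) :
    G.dist u c + G.dist c v = G.dist u v := by
  classical
  have hlen := congrArg Walk.length (p.take_spec hc)
  rw [Walk.length_append] at hlen
  have h₁ := dist_le (p.takeUntil c hc)
  have h₂ := dist_le (p.dropUntil c hc)
  have h₃ := (p.takeUntil c hc).reachable.dist_triangle_left v
  omega

lemma Connected.exists_dist_eq_of_le_dist (hG : G.Connected) {u v : V} {i : ℕ}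
    (hi : i ≤ G.dist u v) : ∃ c, G.dist u c = i ∧ G.dist c v = G.dist u v - i := by
  obtain ⟨p, hp⟩ := hG.exists_walk_length_eq_dist u v
  have h₁ := dist_le (p.take i)
  have h₂ := dist_le (p.drop i)
  have h₃ := hG.dist_triangle (u := u) (v := p.getVert i) (w := v)
  rw [Walk.take_length] at h₁
  rw [Walk.drop_length] at h₂
  exact ⟨p.getVert i, by omega, by omega⟩

/-- In a tree, a vertex `c` on the geodesic from `u` to `v` lies, for every vertex `w`, on the
geodesic from `w` to `u` or on the geodesic from `w` to `v`. -/
lemma IsTree.dist_add_dist_eq_or (hG : G.IsTree) {u v c : V}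
    (hc : G.dist u c + G.dist c v = G.dist u v) (w : V) :
    G.dist u c + G.dist c w = G.dist u w ∨ G.dist w c + G.dist c v = G.dist w v := by
  classical
  obtain ⟨p, hp⟩ := hG.connected.exists_walk_length_eq_dist u c
  obtain ⟨q, hq⟩ := hG.connected.exists_walk_length_eq_dist c v
  obtain ⟨r, hr⟩ := hG.connected.exists_walk_length_eq_dist u w
  obtain ⟨s, hs⟩ := hG.connected.exists_walk_length_eq_dist w v
  have hpq : (p.append q).IsPath :=
    Walk.isPath_of_length_eq_dist _ (by rw [Walk.length_append, hp, hq, hc])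
  have heq : p.append q = (r.append s).bypass :=
    (hG.existsUnique_path u v).unique hpq (Walk.bypass_isPath _)
  have hmem : c ∈ (r.append s).support := by
    apply Walk.support_bypass_subset_support
    rw [← heq, Walk.mem_support_append_iff]
    exact .inl p.end_mem_support
  exact ((Walk.mem_support_append_iff _ _).1 hmem).imp
    (Walk.dist_add_dist_of_mem_support hr) (Walk.dist_add_dist_of_mem_support hs)

end SimpleGraph

/-- Intersection of two balls in a tree: with `d(x,y) = δ`,
(1) if `α + β < δ` the balls `B_α(x)`, `B_β(y)` are disjoint;
(2) if `|α − β| ≤ δ ≤ α + β` and `α + β − δ = 2k`, then the intersection is the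
ball `B_k(c)` where `c` is the vertex on the geodesic from `x` to `y` with
`d(x,c) = (α − β + δ)/2`;
(3) if `δ ≤ |α − β|` the intersection is the smaller ball. -/
theorem stmt_4 {V : Type*} (G : SimpleGraph V) (hG : G.IsTree)
    (x y : V) (δ α β : ℕ) (hδ : G.dist x y = δ) :
    (α + β < δ → {w : V | G.dist w x ≤ α} ∩ {w : V | G.dist w y ≤ β} = ∅) ∧
    (((α : ℤ) - β).natAbs ≤ δ →
      ∀ k : ℕ, α + β = δ + 2 * k →
        ∃ c : V, G.dist x c + G.dist c y = δ ∧ 2 * G.dist x c + β = α + δ ∧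
          {w : V | G.dist w x ≤ α} ∩ {w : V | G.dist w y ≤ β}
            = {w : V | G.dist w c ≤ k}) ∧
    (δ ≤ ((α : ℤ) - β).natAbs →
      (β ≤ α → {w : V | G.dist w x ≤ α} ∩ {w : V | G.dist w y ≤ β}
          = {w : V | G.dist w y ≤ β}) ∧
      (α ≤ β → {w : V | G.dist w x ≤ α} ∩ {w : V | G.dist w y ≤ β}
          = {w : V | G.dist w x ≤ α})) := by
  have tri (a b c : V) : G.dist a c ≤ G.dist a b + G.dist b c := hG.connected.dist_triangle
  refine ⟨fun h ↦ ?_, fun h k hk ↦ ?_, fun h ↦ ⟨fun hle ↦ ?_, fun hle ↦ ?_⟩⟩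
  · ext w
    simp only [Set.mem_inter_iff, Set.mem_ofPred_eq, Set.mem_empty_iff_false, iff_false]
    have := tri x w y
    rw [G.dist_comm (u := x) (v := w)] at this
    omega
  · obtain ⟨c, hxc, hcy⟩ :=
      hG.connected.exists_dist_eq_of_le_dist (u := x) (v := y) (i := α - k) (by omega)
    refine ⟨c, by omega, by omega, ?_⟩
    ext w
    simp only [Set.mem_inter_iff, Set.mem_ofPred_eq]
    have h₁ := tri w c x
    have h₂ := tri w c y
    have h₃ := hG.dist_add_dist_eq_or (u := x) (v := y) (c := c) (by omega) w
    rw [G.dist_comm (u := c) (v := w), G.dist_comm (u := x) (v := w)] at h₃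
    rw [G.dist_comm (u := c) (v := x)] at h₁
    omega
  · refine Set.inter_eq_right.2 fun w hw ↦ ?_
    simp only [Set.mem_ofPred_eq] at hw ⊢
    have := tri w y x
    rw [G.dist_comm (u := y) (v := x)] at this
    omega
  · refine Set.inter_eq_left.2 fun w hw ↦ ?_
    simp only [Set.mem_ofPred_eq] at hw ⊢
    have := tri w x y
    omega
end

section
/- Let q ≥ 2 be an integer, X an infinite (q+1)-regular tree, A an apartment of X, and b a vertex with d(b,A) = δ. Let α, β ≥ 0 be integers with δ < β − α. Then the number of vertices v with d(v,A) ≤ α and d(v,b) ≤ β equals (1 + 2(β − α − δ))·q^α + 2·(q^α − 1)/(q − 1). -/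
open SimpleGraph

section Tree

variable {V : Type*} {G : SimpleGraph V}

/-- A neighbour of `v` that is closer to `u` is unique in a tree. -/
theorem SimpleGraph.IsTree.eq_of_adj_of_dist_add_one (hG : G.IsTree) {u v w w' : V}
    (hw : G.Adj v w) (hw' : G.Adj v w') (hd : G.dist v u = G.dist w u + 1)
    (hd' : G.dist v u = G.dist w' u + 1) : w = w' := by
  have key : ∀ x, G.Adj v x → G.dist v u = G.dist x u + 1 →
      ∃ p : G.Walk v u, p.IsPath ∧ p.snd = x := by
    intro x hx hdx
    obtain ⟨p, hp⟩ := hG.connected.exists_walk_length_eq_dist x u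
    refine ⟨.cons hx p, (Walk.cons hx p).isPath_of_length_eq_dist ?_, by simp⟩
    rw [Walk.length_cons, hp, hdx]
  obtain ⟨p, hp, rfl⟩ := key w hw hd
  obtain ⟨p', hp', rfl⟩ := key w' hw' hd'
  rw [(hG.existsUnique_path v u).unique hp hp']

theorem SimpleGraph.Connected.exists_adj_of_dist_eq_add_one (hG : G.Connected) {u v : V} {k : ℕ}
    (h : G.dist v u = k + 1) : ∃ w, G.Adj v w ∧ G.dist w u = k := by
  obtain ⟨p, hp⟩ := hG.exists_walk_length_eq_dist v u
  cases p with
  | nil => simp at h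
  | @cons _ w _ hw p =>
    rw [Walk.length_cons] at hp
    have h1 : G.dist w u ≤ p.length := G.dist_le p
    have h2 := hG.dist_triangle (u := v) (v := w) (w := u)
    have h3 := dist_eq_one_iff_adj.2 hw
    exact ⟨w, hw, by omega⟩

theorem SimpleGraph.IsTree.dist_left_of_adj (hG : G.IsTree) (u : V) {v w : V} (h : G.Adj v w) :
    G.dist v u = G.dist w u + 1 ∨ G.dist w u = G.dist v u + 1 := by
  simpa only [dist_comm (u := u)] using hG.dist_eq_dist_add_one_of_adj u h

/-- The vertices at height `k` above the point `γ n` of the geodesic `γ`. -/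
def geodesicFiber (G : SimpleGraph V) (γ : ℤ → V) (n : ℤ) (k : ℕ) : Set V :=
  {v | ∀ m, G.dist v (γ m) = k + (m - n).natAbs}

variable {γ : ℤ → V}

theorem geodesicFiber_index_unique {v : V} {n n' : ℤ} {k k' : ℕ}
    (h : v ∈ geodesicFiber G γ n k) (h' : v ∈ geodesicFiber G γ n' k') : n = n' ∧ k = k' := by
  have h1 := h n
  have h2 := h n'
  have h3 := h' n
  have h4 := h' n'
  omega

theorem geodesicFiber_zero (hG : G.IsTree)
    (hgeo : ∀ m n : ℤ, G.dist (γ m) (γ n) = (m - n).natAbs) (n : ℤ) :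
    geodesicFiber G γ n 0 = {γ n} := by
  ext v
  simp only [Set.mem_singleton_iff]
  constructor
  · intro h
    have h1 := h n
    simp only [sub_self, Int.natAbs_zero, add_zero] at h1
    exact hG.connected.dist_eq_zero_iff.1 h1
  · rintro rfl m
    rw [hgeo]
    omega

theorem exists_parent_mem_geodesicFiber (hG : G.IsTree)
    (hgeo : ∀ m n : ℤ, G.dist (γ m) (γ n) = (m - n).natAbs) {n : ℤ} {k : ℕ} {v : V}
    (hv : v ∈ geodesicFiber G γ n (k + 1)) : ∃ p ∈ geodesicFiber G γ n k, G.Adj v p := by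
  obtain ⟨p, hp, hd⟩ := hG.connected.exists_adj_of_dist_eq_add_one (k := k) (by simpa using hv n)
  refine ⟨p, fun m ↦ ?_, hp⟩
  have h1 := hv m
  have h2 := hG.connected.dist_triangle (u := p) (v := γ n) (w := γ m)
  have h3 := hgeo n m
  have h4 := hG.dist_left_of_adj (γ m) hp
  omega

theorem eq_of_mem_geodesicFiber_of_adj (hG : G.IsTree) {n : ℤ} {k : ℕ} {v p p' : V}
    (hv : v ∈ geodesicFiber G γ n (k + 1)) (hp : p ∈ geodesicFiber G γ n k)
    (hp' : p' ∈ geodesicFiber G γ n k) (h : G.Adj v p) (h' : G.Adj v p') : p = p' := by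
  refine hG.eq_of_adj_of_dist_add_one (u := γ n) h h' ?_ ?_
  · rw [hv n, hp n]; omega
  · rw [hv n, hp' n]; omega

theorem mem_geodesicFiber_of_adj_of_ne (hG : G.IsTree) {n : ℤ} {k : ℕ} {v p w : V}
    (hv : v ∈ geodesicFiber G γ n (k + 1)) (hp : p ∈ geodesicFiber G γ n k)
    (h : G.Adj v p) (hw : G.Adj v w) (hne : w ≠ p) : w ∈ geodesicFiber G γ n (k + 2) := by
  intro m
  have h1 := hv m
  have h2 := hp m
  rcases hG.dist_left_of_adj (γ m) hw with h3 | h3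
  · exact absurd (hG.eq_of_adj_of_dist_add_one hw h h3 (by omega)) hne
  · omega

theorem mem_geodesicFiber_one_of_adj (hG : G.IsTree)
    (hadj : ∀ n : ℤ, G.Adj (γ n) (γ (n + 1)))
    (hgeo : ∀ m n : ℤ, G.dist (γ m) (γ n) = (m - n).natAbs) {n : ℤ} {w : V}
    (hw : G.Adj (γ n) w) (h₁ : w ≠ γ (n + 1)) (h₂ : w ≠ γ (n - 1)) :
    w ∈ geodesicFiber G γ n 1 := by
  intro m
  have h0 := hgeo n m
  rcases hG.dist_left_of_adj (γ m) hw with h3 | h3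
  · rcases lt_trichotomy m n with hm | rfl | hm
    · have h4 := hgeo (n - 1) m
      have h5 : G.Adj (γ n) (γ (n - 1)) := by simpa using (hadj (n - 1)).symm
      exact absurd (hG.eq_of_adj_of_dist_add_one hw h5 h3 (by omega)) h₂
    · omega
    · have h4 := hgeo (n + 1) m
      exact absurd (hG.eq_of_adj_of_dist_add_one hw (hadj n) h3 (by omega)) h₁
  · omega

theorem exists_mem_geodesicFiber (hG : G.IsTree)
    (hadj : ∀ n : ℤ, G.Adj (γ n) (γ (n + 1)))
    (hgeo : ∀ m n : ℤ, G.dist (γ m) (γ n) = (m - n).natAbs) (v : V) :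
    ∃ n k, v ∈ geodesicFiber G γ n k := by
  obtain ⟨p⟩ := hG.connected v (γ 0)
  generalize hu : γ 0 = u at p
  induction p with
  | nil => exact ⟨0, 0, by rw [geodesicFiber_zero hG hgeo]; exact hu.symm⟩
  | @cons w v _ hw p ih =>
    obtain ⟨n, k, hv⟩ := ih hu
    cases k with
    | zero =>
      have hv' := hv
      rw [geodesicFiber_zero hG hgeo, Set.mem_singleton_iff] at hv'
      subst hv'
      by_cases h₁ : w = γ (n + 1)
      · exact ⟨n + 1, 0, by rw [geodesicFiber_zero hG hgeo]; exact h₁⟩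
      by_cases h₂ : w = γ (n - 1)
      · exact ⟨n - 1, 0, by rw [geodesicFiber_zero hG hgeo]; exact h₂⟩
      exact ⟨n, 1, mem_geodesicFiber_one_of_adj hG hadj hgeo hw.symm h₁ h₂⟩
    | succ k =>
      obtain ⟨p, hp, hvp⟩ := exists_parent_mem_geodesicFiber hG hgeo hv
      by_cases h : w = p
      · exact ⟨n, k, h ▸ hp⟩
      · exact ⟨n, k + 2, mem_geodesicFiber_of_adj_of_ne hG hv hp hvp hw.symm h⟩

theorem sInf_dist_of_mem_geodesicFiber {n : ℤ} {k : ℕ} {v : V}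
    (hv : v ∈ geodesicFiber G γ n k) :
    sInf ((fun u ↦ G.dist v u) '' Set.range γ) = k := by
  refine IsLeast.csInf_eq ⟨⟨γ n, ⟨n, rfl⟩, by simpa using hv n⟩, ?_⟩
  rintro _ ⟨_, ⟨m, rfl⟩, rfl⟩
  have := hv m
  simp only
  omega

theorem dist_le_of_mem_geodesicFiber (hG : G.IsTree) {n n' : ℤ} {k k' : ℕ} {v b : V}
    (hv : v ∈ geodesicFiber G γ n k) (hb : b ∈ geodesicFiber G γ n' k') :
    G.dist v b ≤ k + (n - n').natAbs + k' := by
  have h1 := hG.connected.dist_triangle (u := v) (v := γ n) (w := b)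
  have h2 := hv n
  have h3 := hb n
  rw [dist_comm (u := b)] at h3
  omega

theorem dist_of_mem_geodesicFiber_of_ne (hG : G.IsTree)
    (hadj : ∀ n : ℤ, G.Adj (γ n) (γ (n + 1)))
    (hgeo : ∀ m n : ℤ, G.dist (γ m) (γ n) = (m - n).natAbs) {n n' : ℤ} (hn : n ≠ n') {k' : ℕ}
    {b : V} (hb : b ∈ geodesicFiber G γ n' k') (k : ℕ) :
    ∀ v ∈ geodesicFiber G γ n k, G.dist v b = k + (n - n').natAbs + k' := by
  have base (m : ℤ) : G.dist (γ m) b = (m - n').natAbs + k' := by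
    rw [dist_comm, hb m, add_comm]
  induction k using Nat.twoStepInduction with
  | zero =>
    intro v hv
    rw [geodesicFiber_zero hG hgeo, Set.mem_singleton_iff] at hv
    rw [hv, base, zero_add]
  | one =>
    intro v hv
    obtain ⟨p, hp, hvp⟩ := exists_parent_mem_geodesicFiber hG hgeo hv
    rw [geodesicFiber_zero hG hgeo, Set.mem_singleton_iff] at hp
    subst hp
    have h0 := base n
    rcases hG.dist_left_of_adj b hvp with h | h
    · omega
    · obtain ⟨m, hm, hm'⟩ : ∃ m, G.Adj (γ n) (γ m) ∧ (n - n').natAbs = (m - n').natAbs + 1 := by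
        rcases lt_or_gt_of_ne hn with hlt | hlt
        · exact ⟨n + 1, hadj n, by omega⟩
        · exact ⟨n - 1, by simpa using (hadj (n - 1)).symm, by omega⟩
      have h1 := base m
      have h2 : v = γ m := hG.eq_of_adj_of_dist_add_one hvp.symm hm h (by omega)
      have h3 : v ∈ geodesicFiber G γ m 0 := by
        rw [geodesicFiber_zero hG hgeo]; exact h2
      have := (geodesicFiber_index_unique hv h3).2
      omega
  | more k ih₀ ih₁ =>
    intro v hv
    obtain ⟨p, hp, hvp⟩ := exists_parent_mem_geodesicFiber hG hgeo hv
    obtain ⟨r, hr, hpr⟩ := exists_parent_mem_geodesicFiber hG hgeo hp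
    have h0 := ih₀ r hr
    have h1 := ih₁ p hp
    rcases hG.dist_left_of_adj b hvp with h | h
    · omega
    · have h2 : v = r := hG.eq_of_adj_of_dist_add_one hvp.symm hpr h (by omega)
      subst h2
      have := (geodesicFiber_index_unique hv hr).2
      omega

end Tree

theorem Set.ncard_biUnion_of_ncard_eq {ι κ : Type*} {s : Set ι} (hs : s.Finite) {t : ι → Set κ}
    (ht : ∀ i ∈ s, (t i).Finite) (hd : s.PairwiseDisjoint t) {c : ℕ}
    (hc : ∀ i ∈ s, (t i).ncard = c) : (⋃ i ∈ s, t i).ncard = s.ncard * c := by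
  rw [hs.ncard_biUnion ht hd, finsum_mem_congr rfl hc, finsum_mem_eq_finite_toFinset_sum _ hs,
    Finset.sum_const, smul_eq_mul, Set.ncard_eq_toFinset_card s hs]

section Regular

variable {V : Type*} {G : SimpleGraph V} {γ : ℤ → V} {q : ℕ}

/-- If every vertex of one layer has `c` neighbours in the next, cardinalities multiply by `c`. -/
theorem ncard_geodesicFiber_succ_of_forall (hG : G.IsTree)
    (hgeo : ∀ m n : ℤ, G.dist (γ m) (γ n) = (m - n).natAbs)
    (hfin : ∀ v, (G.neighborSet v).Finite) {n : ℤ} {k c : ℕ}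
    (hk : (geodesicFiber G γ n k).Finite)
    (hc : ∀ p ∈ geodesicFiber G γ n k,
      (G.neighborSet p ∩ geodesicFiber G γ n (k + 1)).ncard = c) :
    (geodesicFiber G γ n (k + 1)).Finite ∧
      (geodesicFiber G γ n (k + 1)).ncard = (geodesicFiber G γ n k).ncard * c := by
  have hU : geodesicFiber G γ n (k + 1) =
      ⋃ p ∈ geodesicFiber G γ n k, G.neighborSet p ∩ geodesicFiber G γ n (k + 1) := by
    ext v
    simp only [Set.mem_iUnion, Set.mem_inter_iff, mem_neighborSet, exists_prop]
    constructor
    · intro hv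
      obtain ⟨p, hp, hvp⟩ := exists_parent_mem_geodesicFiber hG hgeo hv
      exact ⟨p, hp, hvp.symm, hv⟩
    · rintro ⟨_, _, _, hv⟩
      exact hv
  have hfin' : ∀ p ∈ geodesicFiber G γ n k,
      (G.neighborSet p ∩ geodesicFiber G γ n (k + 1)).Finite :=
    fun p _ ↦ (hfin p).subset Set.inter_subset_left
  constructor
  · rw [hU]
    exact hk.biUnion hfin'
  · rw [← Set.ncard_biUnion_of_ncard_eq hk hfin' ?_ hc, ← hU]
    intro p hp p' hp' hne
    refine Set.disjoint_left.2 fun v hv hv' ↦ hne ?_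
    exact eq_of_mem_geodesicFiber_of_adj hG hv.2 hp hp' hv.1.symm hv'.1.symm

theorem ncard_neighborSet_inter_geodesicFiber_one (hG : G.IsTree)
    (hreg : ∀ v : V, (G.neighborSet v).ncard = q + 1)
    (hadj : ∀ n : ℤ, G.Adj (γ n) (γ (n + 1)))
    (hgeo : ∀ m n : ℤ, G.dist (γ m) (γ n) = (m - n).natAbs) (n : ℤ) :
    (G.neighborSet (γ n) ∩ geodesicFiber G γ n 1).ncard = q - 1 := by
  have hne : γ (n + 1) ≠ γ (n - 1) := by
    intro h
    have := hgeo (n + 1) (n - 1)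
    rw [h, dist_self] at this
    omega
  have hsub : ({γ (n + 1), γ (n - 1)} : Set V) ⊆ G.neighborSet (γ n) := by
    rintro _ (rfl | rfl)
    · exact hadj n
    · simpa using (hadj (n - 1)).symm
  have hset : G.neighborSet (γ n) ∩ geodesicFiber G γ n 1 =
      G.neighborSet (γ n) \ {γ (n + 1), γ (n - 1)} := by
    ext w
    simp only [Set.mem_inter_iff, Set.mem_sdiff, Set.mem_insert_iff, Set.mem_singleton_iff, not_or]
    refine and_congr_right fun hw ↦ ⟨fun h ↦ ⟨?_, ?_⟩, fun h ↦
      mem_geodesicFiber_one_of_adj hG hadj hgeo hw h.1 h.2⟩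
    · rintro rfl
      simpa using h (n + 1)
    · rintro rfl
      simpa using h (n - 1)
  rw [hset, Set.ncard_sdiff hsub, hreg, Set.ncard_pair hne]
  omega

theorem ncard_neighborSet_inter_geodesicFiber_add_two (hG : G.IsTree)
    (hreg : ∀ v : V, (G.neighborSet v).ncard = q + 1)
    (hgeo : ∀ m n : ℤ, G.dist (γ m) (γ n) = (m - n).natAbs) {n : ℤ} {k : ℕ} {v : V}
    (hv : v ∈ geodesicFiber G γ n (k + 1)) :
    (G.neighborSet v ∩ geodesicFiber G γ n (k + 2)).ncard = q := by
  obtain ⟨p, hp, hvp⟩ := exists_parent_mem_geodesicFiber hG hgeo hv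
  have hset : G.neighborSet v ∩ geodesicFiber G γ n (k + 2) = G.neighborSet v \ {p} := by
    ext w
    simp only [Set.mem_inter_iff, Set.mem_sdiff, Set.mem_singleton_iff]
    refine and_congr_right fun hw ↦ ⟨?_, mem_geodesicFiber_of_adj_of_ne hG hv hp hvp hw⟩
    rintro h rfl
    have := (geodesicFiber_index_unique h hp).2
    omega
  rw [hset, Set.ncard_sdiff_singleton_of_mem (show p ∈ G.neighborSet v from hvp), hreg,
    Nat.add_sub_cancel]

theorem ncard_geodesicFiber_succ (hG : G.IsTree)
    (hreg : ∀ v : V, (G.neighborSet v).ncard = q + 1)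
    (hadj : ∀ n : ℤ, G.Adj (γ n) (γ (n + 1)))
    (hgeo : ∀ m n : ℤ, G.dist (γ m) (γ n) = (m - n).natAbs) (n : ℤ) (k : ℕ) :
    (geodesicFiber G γ n (k + 1)).Finite ∧
      (geodesicFiber G γ n (k + 1)).ncard = (q - 1) * q ^ k := by
  have hfin : ∀ v, (G.neighborSet v).Finite := fun v ↦
    Set.finite_of_ncard_pos (by rw [hreg]; omega)
  induction k with
  | zero =>
    have h0 := geodesicFiber_zero hG hgeo n
    have := ncard_geodesicFiber_succ_of_forall hG hgeo hfin (n := n) (k := 0) (c := q - 1)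
      (by rw [h0]; exact Set.finite_singleton _) (by
        rw [h0]
        rintro _ rfl
        exact ncard_neighborSet_inter_geodesicFiber_one hG hreg hadj hgeo n)
    rw [h0, Set.ncard_singleton] at this
    simpa using this
  | succ k ih =>
    have := ncard_geodesicFiber_succ_of_forall hG hgeo hfin ih.1
      (fun p hp ↦ ncard_neighborSet_inter_geodesicFiber_add_two hG hreg hgeo hp)
    rw [ih.2] at this
    exact ⟨this.1, this.2.trans (by ring)⟩

theorem finite_geodesicFiber (hG : G.IsTree)
    (hreg : ∀ v : V, (G.neighborSet v).ncard = q + 1)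
    (hadj : ∀ n : ℤ, G.Adj (γ n) (γ (n + 1)))
    (hgeo : ∀ m n : ℤ, G.dist (γ m) (γ n) = (m - n).natAbs) (n : ℤ) (k : ℕ) :
    (geodesicFiber G γ n k).Finite := by
  cases k with
  | zero => rw [geodesicFiber_zero hG hgeo]; exact Set.finite_singleton _
  | succ k => exact (ncard_geodesicFiber_succ hG hreg hadj hgeo n k).1

/-- The slab of width `2 * r + 1` around `γ n₀` at height `k`. -/
theorem ncard_biUnion_geodesicFiber (hG : G.IsTree)
    (hreg : ∀ v : V, (G.neighborSet v).ncard = q + 1)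
    (hadj : ∀ n : ℤ, G.Adj (γ n) (γ (n + 1)))
    (hgeo : ∀ m n : ℤ, G.dist (γ m) (γ n) = (m - n).natAbs) (n₀ : ℤ) (r k : ℕ) :
    (⋃ n ∈ Set.Icc (n₀ - r) (n₀ + r), geodesicFiber G γ n k).ncard =
      (2 * r + 1) * (geodesicFiber G γ 0 k).ncard := by
  rw [Set.ncard_biUnion_of_ncard_eq (Set.finite_Icc _ _)
    (fun n _ ↦ finite_geodesicFiber hG hreg hadj hgeo n k)
    (fun n _ n' _ hne ↦ Set.disjoint_left.2 fun v hv hv' ↦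
      hne (geodesicFiber_index_unique hv hv').1) (c := (geodesicFiber G γ 0 k).ncard)]
  · rw [← Finset.coe_Icc, Set.ncard_coe_finset, Int.card_Icc]
    congr 1
    omega
  · intro n _
    cases k with
    | zero => simp [geodesicFiber_zero hG hgeo]
    | succ k =>
      rw [(ncard_geodesicFiber_succ hG hreg hadj hgeo n k).2,
        (ncard_geodesicFiber_succ hG hreg hadj hgeo 0 k).2]

end Regular

/-- In an infinite (q+1)-regular tree with apartment `A`, a vertex `b` with
`d(b,A) = δ`, and integers `α, β ≥ 0` with `δ < β − α`, the number of vertices `v`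
with `d(v,A) ≤ α` and `d(v,b) ≤ β` equals
`(1 + 2(β − α − δ))·q^α + 2·(q^α − 1)/(q − 1)`. -/
theorem stmt_6 {V : Type*} (G : SimpleGraph V) (hG : G.IsTree) [Infinite V]
    (q : ℕ) (hq : 2 ≤ q)
    (hreg : ∀ v : V, (G.neighborSet v).ncard = q + 1)
    (γ : ℤ → V)
    (hadj : ∀ n : ℤ, G.Adj (γ n) (γ (n + 1)))
    (hgeo : ∀ m n : ℤ, G.dist (γ m) (γ n) = (m - n).natAbs)
    (b : V) (δ : ℕ)
    (hδ : sInf ((fun u => G.dist b u) '' Set.range γ) = δ)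
    (α β : ℕ) (h : (δ : ℤ) < (β : ℤ) - (α : ℤ)) :
    ({v : V | sInf ((fun u => G.dist v u) '' Set.range γ) ≤ α ∧ G.dist v b ≤ β}.ncard : ℚ)
      = (1 + 2 * ((β : ℚ) - (α : ℚ) - (δ : ℚ))) * (q : ℚ) ^ α
        + 2 * ((q : ℚ) ^ α - 1) / ((q : ℚ) - 1) := by
  obtain ⟨n₀, δ', hb⟩ := exists_mem_geodesicFiber hG hadj hgeo b
  obtain rfl : δ' = δ := (sInf_dist_of_mem_geodesicFiber hb).symm.trans hδ
  have hset : {v : V | sInf ((fun u => G.dist v u) '' Set.range γ) ≤ α ∧ G.dist v b ≤ β} =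
      ⋃ k ∈ (Finset.range (α + 1) : Set ℕ),
        ⋃ n ∈ Set.Icc (n₀ - (β - δ' - k : ℕ)) (n₀ + (β - δ' - k : ℕ)), geodesicFiber G γ n k := by
    ext v
    obtain ⟨n, k, hv⟩ := exists_mem_geodesicFiber hG hadj hgeo v
    simp only [Set.mem_ofPred_eq, sInf_dist_of_mem_geodesicFiber hv, Set.mem_iUnion, exists_prop,
      Finset.coe_range, Set.mem_Iio, Set.mem_Icc]
    have hle := dist_le_of_mem_geodesicFiber hG hv hb
    constructor
    · rintro ⟨h₁, h₂⟩
      refine ⟨k, by omega, n, ?_, hv⟩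
      by_cases hn : n = n₀
      · omega
      · have := dist_of_mem_geodesicFiber_of_ne hG hadj hgeo hn hb k v hv
        omega
    · rintro ⟨k', hk', n', hn', hv'⟩
      obtain ⟨rfl, rfl⟩ := geodesicFiber_index_unique hv hv'
      omega
  rw [hset, (Finset.finite_toSet _).ncard_biUnion
    (fun k _ ↦ (Set.finite_Icc _ _).biUnion fun n _ ↦ finite_geodesicFiber hG hreg hadj hgeo n k)
    (fun k _ k' _ hne ↦ Set.disjoint_left.2 fun v hv hv' ↦ hne ?_), finsum_mem_coe_finset]
  swap
  · simp only [Set.mem_iUnion, exists_prop] at hv hv'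
    obtain ⟨n, -, hv⟩ := hv
    obtain ⟨n', -, hv'⟩ := hv'
    exact (geodesicFiber_index_unique hv hv').2
  simp only [ncard_biUnion_geodesicFiber hG hreg hadj hgeo]
  have hq1 : (q : ℚ) - 1 ≠ 0 := by
    have : (2 : ℚ) ≤ q := by exact_mod_cast hq
    linarith
  have hαβ : α + δ' < β := by omega
  clear h hset hb hδ
  induction α with
  | zero =>
    simp only [zero_add, Finset.sum_range_one, Nat.sub_zero,
      geodesicFiber_zero hG hgeo, Set.ncard_singleton]
    push_cast [Nat.cast_sub (show δ' ≤ β by omega)]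
    ring
  | succ α ih =>
    rw [Finset.sum_range_succ, Nat.cast_add, ih (by omega),
      (ncard_geodesicFiber_succ hG hreg hadj hgeo 0 α).2]
    push_cast [Nat.cast_sub (show δ' ≤ β by omega),
      Nat.cast_sub (show α + 1 ≤ β - δ' by omega), Nat.cast_sub (show 1 ≤ q by omega)]
    field_simp
    ring
end

section
/- Let q ≥ 2 be an integer, X an infinite (q+1)-regular tree, A an apartment of X, v a vertex with d(v,A) = δ, and a the vertex of A nearest to v. Let α, β ≥ 0 be integers, T_α(A) = {w : d(w,A) ≤ α}, and B_β(v) = {w : d(w,v) ≤ β}. Then the number of vertices in T_α(A) ∩ B_β(v) equals: 0 if α + β < δ; the cardinality of B_α(a) ∩ B_β(v) if β − α ≤ δ ≤ α + β; and (1 + 2(β − α − δ))·q^α + 2·(q^α − 1)/(q − 1) if δ ≤ β − α. -/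
open Finset in
/-- Summing an even function over a symmetric integer interval. -/
lemma sum_Icc_neg_natAbs (f : ℕ → ℕ) (m : ℕ) :
    ∑ n ∈ Icc (-(m : ℤ)) m, f n.natAbs = f 0 + 2 * ∑ j ∈ range m, f (j + 1) := by
  induction m with
  | zero => simp
  | succ m ih =>
    have h : Icc (-((m + 1 : ℕ) : ℤ)) (m + 1 : ℕ)
        = insert (-((m + 1 : ℕ) : ℤ)) (insert ((m + 1 : ℕ) : ℤ) (Icc (-(m : ℤ)) m)) := by
      ext n
      simp only [mem_Icc, mem_insert]
      omega
    rw [h, sum_insert, sum_insert, ih, sum_range_succ]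
    · have h1 : (-((m + 1 : ℕ) : ℤ)).natAbs = m + 1 := by omega
      have h2 : (((m + 1 : ℕ) : ℤ)).natAbs = m + 1 := by omega
      rw [h1, h2]
      ring
    · simp only [mem_Icc]
      omega
    · simp only [mem_Icc, mem_insert]
      omega

namespace SimpleGraph

variable {V : Type*} {G : SimpleGraph V}

/-- In a tree, a vertex has at most one neighbour closer to a given vertex. -/
lemma IsTree.eq_of_adj_of_dist_add_one_s7 (hG : G.IsTree) {w u x y : V} (hx : G.Adj u x)
    (hy : G.Adj u y) (hdx : G.dist w u = G.dist w x + 1) (hdy : G.dist w u = G.dist w y + 1) :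
    x = y := by
  obtain ⟨p, hp⟩ := hG.connected.exists_walk_length_eq_dist w x
  obtain ⟨r, hr⟩ := hG.connected.exists_walk_length_eq_dist w y
  have hp' : (p.concat hx.symm).IsPath :=
    Walk.isPath_of_length_eq_dist _ (by rw [Walk.length_concat, hp, hdx])
  have hr' : (r.concat hy.symm).IsPath :=
    Walk.isPath_of_length_eq_dist _ (by rw [Walk.length_concat, hr, hdy])
  have h := (hG.existsUnique_path w u).unique hp' hr'
  simpa using congrArg Walk.penultimate h

lemma IsTree.dist_eq_dist_add_one_of_adj_of_ne (hG : G.IsTree) {w u x y : V} (hx : G.Adj u x)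
    (hy : G.Adj u y) (hxy : x ≠ y) (hdx : G.dist w u = G.dist w x + 1) :
    G.dist w y = G.dist w u + 1 :=
  (hG.dist_eq_dist_add_one_of_adj w hy).resolve_left
    fun h => hxy (hG.eq_of_adj_of_dist_add_one_s7 hx hy hdx h)

lemma Connected.exists_adj_dist_eq_dist_add_one (hG : G.Connected) {w u : V} (h : w ≠ u) :
    ∃ x, G.Adj u x ∧ G.dist w u = G.dist w x + 1 := by
  obtain ⟨p, hp⟩ := hG.exists_walk_length_eq_dist u w
  cases p with
  | nil => exact absurd rfl h
  | @cons _ x _ hx p =>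
    refine ⟨x, hx, ?_⟩
    have h1 := dist_le p
    have h2 := hG.dist_triangle (u := w) (v := x) (w := u)
    have h3 := dist_eq_one_iff_adj.2 hx.symm
    rw [Walk.length_cons] at hp
    rw [dist_comm] at hp h1
    omega

/-- In a tree, if the edge between `c` and `c'` separates `w` from `v`, then the distance from
`w` to `v` is the length of the concatenation through that edge. -/
lemma IsTree.dist_eq_of_adj_separates (hG : G.IsTree) {w v c c' : V} (hc : G.Adj c c')
    (hw : G.dist w c' = G.dist w c + 1) (hv : G.dist v c = G.dist v c' + 1) :
    G.dist w v = G.dist w c + 1 + G.dist v c' := by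
  induction h : G.dist v c' generalizing c c' with
  | zero =>
    rw [hG.connected.dist_eq_zero_iff] at h
    rw [h, hw, add_zero]
  | succ k ih =>
    have hne : v ≠ c' := by
      rintro rfl
      simp at h
    obtain ⟨x, hx, hdx⟩ := hG.connected.exists_adj_dist_eq_dist_add_one hne
    have hcx : c ≠ x := by
      rintro rfl
      omega
    have hwx := hG.dist_eq_dist_add_one_of_adj_of_ne hc.symm hx hcx hw
    rw [ih hx hwx hdx (by omega)]
    omega

open Finset in
/-- In a `(q + 1)`-regular tree, the ball of radius `k + 1` around `c`, with the branches through
the neighbours in `P` removed, consists of `c` and of the truncated branches through the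
remaining neighbours of `c`. -/
lemma IsTree.exists_finset_branches_succ (hG : G.IsTree) {q : ℕ}
    (hreg : ∀ v : V, (G.neighborSet v).ncard = q + 1) {c : V} {P : Finset V}
    (hPc : ∀ p ∈ P, G.Adj c p) {k N : ℕ}
    (H : ∀ x, G.Adj c x → ∃ s : Finset V,
      (∀ w, w ∈ s ↔ G.dist w x ≤ k ∧ G.dist w c = G.dist w x + 1) ∧ s.card = N) :
    ∃ s : Finset V, (∀ w, w ∈ s ↔ G.dist w c ≤ k + 1 ∧ ∀ p ∈ P, G.dist w p = G.dist w c + 1) ∧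
      s.card = 1 + (q + 1 - P.card) * N := by
  classical
  have hfin : (G.neighborSet c).Finite := Set.finite_of_ncard_ne_zero (by rw [hreg]; omega)
  choose! F hF hFc using H
  set T := hfin.toFinset \ P with hT
  have hTmem : ∀ x, x ∈ T ↔ G.Adj c x ∧ x ∉ P := fun x => by simp [hT]
  have hTcard : T.card = q + 1 - P.card := by
    rw [hT, card_sdiff_of_subset, ← Set.ncard_eq_toFinset_card _ hfin, hreg]
    intro p hp
    simpa using hPc p hp
  refine ⟨insert c (T.biUnion F), fun w => ?_, ?_⟩
  · simp only [mem_insert, mem_biUnion]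
    constructor
    · rintro (rfl | ⟨x, hx, hw⟩)
      · refine ⟨by simp, fun p hp => ?_⟩
        simpa using hPc p hp
      · obtain ⟨hcx, hxP⟩ := (hTmem x).1 hx
        obtain ⟨h1, h2⟩ := (hF x hcx w).1 hw
        refine ⟨by omega, fun p hp => ?_⟩
        exact hG.dist_eq_dist_add_one_of_adj_of_ne hcx (hPc p hp)
          (fun h => hxP (h ▸ hp)) h2
    · rintro ⟨h1, h2⟩
      by_cases hwc : w = c
      · exact Or.inl hwc
      · obtain ⟨x, hx, hdx⟩ := hG.connected.exists_adj_dist_eq_dist_add_one hwc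
        refine Or.inr ⟨x, (hTmem x).2 ⟨hx, fun hxP => ?_⟩, (hF x hx w).2 ⟨by omega, hdx⟩⟩
        have := h2 x hxP
        omega
  · rw [card_insert_of_notMem, card_biUnion, sum_congr rfl, sum_const, hTcard, smul_eq_mul,
      add_comm]
    · exact fun x hx => hFc x ((hTmem x).1 hx).1
    · intro x hx y hy hxy
      rw [Function.onFun, Finset.disjoint_left]
      intro w hwx hwy
      have hx' := ((hTmem x).1 hx).1
      have hy' := ((hTmem y).1 hy).1
      exact hxy (hG.eq_of_adj_of_dist_add_one_s7 hx' hy' ((hF x hx' w).1 hwx).2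
        ((hF y hy' w).1 hwy).2)
    · simp only [mem_biUnion, not_exists, not_and]
      intro x hx hc
      have := ((hF x ((hTmem x).1 hx).1 c).1 hc).2
      simp at this

lemma IsTree.mem_branches_zero_iff (hG : G.IsTree) {c w : V} {P : Finset V}
    (hPc : ∀ p ∈ P, G.Adj c p) :
    w ∈ ({c} : Finset V) ↔ G.dist w c ≤ 0 ∧ ∀ p ∈ P, G.dist w p = G.dist w c + 1 := by
  rw [Finset.mem_singleton, Nat.le_zero, hG.connected.dist_eq_zero_iff]
  constructor
  · rintro rfl
    refine ⟨rfl, fun p hp => ?_⟩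
    simpa using hPc p hp
  · exact fun h => h.1

/-- The number of vertices at distance at most `k` from `c` on the side of `c` of the edge
between `p` and `c` of a regular tree. -/
lemma IsTree.exists_finset_halfBall (hG : G.IsTree) {q : ℕ}
    (hreg : ∀ v : V, (G.neighborSet v).ncard = q + 1) (k : ℕ) {p c : V} (hpc : G.Adj p c) :
    ∃ s : Finset V, (∀ w, w ∈ s ↔ G.dist w c ≤ k ∧ G.dist w p = G.dist w c + 1) ∧
      s.card = ∑ i ∈ Finset.range (k + 1), q ^ i := by
  induction k generalizing p c with
  | zero =>
    refine ⟨{c}, fun w => ?_, by simp⟩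
    rw [hG.mem_branches_zero_iff (P := {p}) (by simpa using hpc.symm)]
    simp
  | succ k ih =>
    obtain ⟨s, hs, hsc⟩ := hG.exists_finset_branches_succ hreg (c := c) (P := {p})
      (by simpa using hpc.symm) (fun x hx => ih hx)
    refine ⟨s, by simpa using hs, ?_⟩
    rw [hsc, Finset.sum_range_succ' _ (k + 1), Finset.card_singleton, Finset.mul_sum, add_comm]
    simp [pow_succ, mul_comm]

/-- The number of vertices at distance at most `k` from `c` outside the branches through two
neighbours of `c` in a regular tree. -/
lemma IsTree.exists_finset_ball_two_branches (hG : G.IsTree) {q : ℕ} (hq : 1 ≤ q)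
    (hreg : ∀ v : V, (G.neighborSet v).ncard = q + 1) (k : ℕ) {c x y : V} (hx : G.Adj c x)
    (hy : G.Adj c y) (hxy : x ≠ y) :
    ∃ s : Finset V, (∀ w, w ∈ s ↔ G.dist w c ≤ k ∧
      (G.dist w x = G.dist w c + 1 ∧ G.dist w y = G.dist w c + 1)) ∧ s.card = q ^ k := by
  classical
  have hP : ∀ p ∈ ({x, y} : Finset V), G.Adj c p := by simp [hx, hy]
  cases k with
  | zero =>
    refine ⟨{c}, fun w => ?_, by simp⟩
    rw [hG.mem_branches_zero_iff hP]
    simp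
  | succ k =>
    obtain ⟨s, hs, hsc⟩ := hG.exists_finset_branches_succ hreg hP
      (fun x hx => hG.exists_finset_halfBall hreg k hx)
    refine ⟨s, by simpa using hs, ?_⟩
    rw [hsc, Finset.card_pair hxy]
    obtain ⟨r, rfl⟩ : ∃ r, q = r + 1 := ⟨q - 1, by omega⟩
    have h := mul_geom_sum (r + 1 : ℤ) (k + 1)
    have h2 : r + 1 + 1 - 2 = r := by omega
    rw [h2]
    zify
    rw [add_sub_cancel_right] at h
    rw [h]
    ring

/-- `γ n` is the foot of `w` on the bi-infinite path `γ`: both neighbours of `γ n` on the path are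
further away from `w`. -/
def IsFoot (G : SimpleGraph V) (γ : ℤ → V) (n : ℤ) (w : V) : Prop :=
  G.dist w (γ (n + 1)) = G.dist w (γ n) + 1 ∧ G.dist w (γ (n - 1)) = G.dist w (γ n) + 1

section Apartment

variable {γ : ℤ → V}

lemma IsTree.exists_isFoot (hG : G.IsTree) (hadj : ∀ n : ℤ, G.Adj (γ n) (γ (n + 1))) (w : V) :
    ∃ n, IsFoot G γ n w := by
  obtain ⟨n, hn⟩ : ∃ n, ∀ m, G.dist w (γ n) ≤ G.dist w (γ m) := by
    let S := Set.range fun m => G.dist w (γ m)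
    obtain ⟨n, hn⟩ : sInf S ∈ S := Nat.sInf_mem (Set.range_nonempty _)
    exact ⟨n, fun m => (le_of_eq hn).trans (Nat.sInf_le ⟨m, rfl⟩)⟩
  have h := hadj (n - 1)
  rw [sub_add_cancel] at h
  have h1 := hG.dist_eq_dist_add_one_of_adj w (hadj n)
  have h2 := hG.dist_eq_dist_add_one_of_adj w h.symm
  have h3 := hn (n + 1)
  have h4 := hn (n - 1)
  exact ⟨n, by omega, by omega⟩

lemma IsFoot.dist_eq (hG : G.IsTree) (hadj : ∀ n : ℤ, G.Adj (γ n) (γ (n + 1)))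
    (hgeo : ∀ m n : ℤ, G.dist (γ m) (γ n) = (m - n).natAbs) {n : ℤ} {w : V}
    (hw : IsFoot G γ n w) (m : ℤ) :
    G.dist w (γ m) = G.dist w (γ n) + (m - n).natAbs := by
  rcases lt_trichotomy m n with h | rfl | h
  · have h' := hadj (n - 1)
    rw [sub_add_cancel] at h'
    have := hG.dist_eq_of_adj_separates h'.symm hw.2 (v := γ m)
      (by rw [hgeo, hgeo]; omega)
    rw [this, hgeo]
    omega
  · simp
  · have := hG.dist_eq_of_adj_separates (hadj n) hw.1 (v := γ m)
      (by rw [hgeo, hgeo]; omega)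
    rw [this, hgeo]
    omega

lemma IsFoot.sInf_dist_eq (hG : G.IsTree) (hadj : ∀ n : ℤ, G.Adj (γ n) (γ (n + 1)))
    (hgeo : ∀ m n : ℤ, G.dist (γ m) (γ n) = (m - n).natAbs) {n : ℤ} {w : V}
    (hw : IsFoot G γ n w) :
    sInf ((fun u => G.dist w u) '' Set.range γ) = G.dist w (γ n) := by
  apply le_antisymm
  · exact Nat.sInf_le ⟨γ n, ⟨n, rfl⟩, rfl⟩
  · refine le_csInf ⟨_, γ n, ⟨n, rfl⟩, rfl⟩ ?_
    rintro _ ⟨_, ⟨m, rfl⟩, rfl⟩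
    have := hw.dist_eq hG hadj hgeo m
    simp only
    omega

lemma IsFoot.eq_of_dist_le (hG : G.IsTree) (hadj : ∀ n : ℤ, G.Adj (γ n) (γ (n + 1)))
    (hgeo : ∀ m n : ℤ, G.dist (γ m) (γ n) = (m - n).natAbs) {m n : ℤ} {w : V}
    (hw : IsFoot G γ n w) (h : G.dist w (γ m) ≤ G.dist w (γ n)) : m = n := by
  have := hw.dist_eq hG hadj hgeo m
  omega

/-- Vertices with different feet are joined through the path `γ`. -/
lemma IsFoot.dist_eq_of_ne (hG : G.IsTree) (hadj : ∀ n : ℤ, G.Adj (γ n) (γ (n + 1)))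
    (hgeo : ∀ m n : ℤ, G.dist (γ m) (γ n) = (m - n).natAbs) {m n : ℤ} {w v : V}
    (hw : IsFoot G γ m w) (hv : IsFoot G γ n v) (hmn : m ≠ n) :
    G.dist w v = G.dist w (γ m) + (m - n).natAbs + G.dist v (γ n) := by
  have hvd := hv.dist_eq hG hadj hgeo
  rcases hmn.lt_or_gt with h | h
  · have h1 := hvd m
    have h2 := hvd (m + 1)
    rw [hG.dist_eq_of_adj_separates (hadj m) hw.1 (by omega)]
    omega
  · have h1 := hvd m
    have h2 := hvd (m - 1)
    have h' := hadj (m - 1)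
    rw [sub_add_cancel] at h'
    rw [hG.dist_eq_of_adj_separates h'.symm hw.2 (by omega)]
    omega

open Finset in
/-- The number of vertices of a regular tree whose height over the path `γ` is at most `α` and
at most `m` minus the distance of their foot to `γ i`. -/
lemma IsTree.exists_finset_tube_inter_ball (hG : G.IsTree) {q : ℕ} (hq : 1 ≤ q)
    (hreg : ∀ v : V, (G.neighborSet v).ncard = q + 1)
    (hadj : ∀ n : ℤ, G.Adj (γ n) (γ (n + 1)))
    (hgeo : ∀ m n : ℤ, G.dist (γ m) (γ n) = (m - n).natAbs) (i : ℤ) (α m : ℕ) :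
    ∃ s : Finset V, (∀ w, w ∈ s ↔ ∃ n : ℤ, IsFoot G γ (i + n) w ∧
        G.dist w (γ (i + n)) ≤ α ∧ G.dist w (γ (i + n)) + n.natAbs ≤ m) ∧
      s.card = ∑ n ∈ Icc (-(m : ℤ)) m, q ^ min α (m - n.natAbs) := by
  classical
  have H : ∀ n : ℤ, ∃ s : Finset V, (∀ w, w ∈ s ↔
      G.dist w (γ (i + n)) ≤ min α (m - n.natAbs) ∧ IsFoot G γ (i + n) w) ∧
      s.card = q ^ min α (m - n.natAbs) := fun n => by
    have h := hadj (i + n - 1)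
    rw [sub_add_cancel] at h
    refine hG.exists_finset_ball_two_branches hq hreg _ (hadj _) h.symm fun he => ?_
    have := hgeo (i + n + 1) (i + n - 1)
    rw [he, dist_self] at this
    omega
  choose F hF hFc using H
  refine ⟨(Icc (-(m : ℤ)) m).biUnion F, fun w => ?_, ?_⟩
  · simp only [mem_biUnion, mem_Icc, hF]
    constructor
    · rintro ⟨n, hn, h, hw⟩
      exact ⟨n, hw, by omega, by omega⟩
    · rintro ⟨n, hw, h1, h2⟩
      exact ⟨n, by omega, by omega, hw⟩
  · rw [card_biUnion, sum_congr rfl fun n _ => hFc n]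
    intro n _ n' _ hne
    rw [Function.onFun, Finset.disjoint_left]
    intro w hw hw'
    have h1 := ((hF n w).1 hw).2.dist_eq hG hadj hgeo (i + n')
    have h2 := ((hF n' w).1 hw').2.dist_eq hG hadj hgeo (i + n)
    omega

end Apartment

end SimpleGraph

open Finset in
lemma sum_pow_min_symmetric {q : ℕ} (hq : 2 ≤ q) (α t : ℕ) :
    ((∑ n ∈ Icc (-((α + t : ℕ) : ℤ)) (α + t : ℕ), q ^ min α (α + t - n.natAbs) : ℕ) : ℚ)
      = (1 + 2 * (t : ℚ)) * (q : ℚ) ^ α + 2 * ((q : ℚ) ^ α - 1) / ((q : ℚ) - 1) := by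
  have hq1 : (q : ℚ) ≠ 1 := by
    have : q ≠ 1 := by omega
    exact_mod_cast this
  rw [sum_Icc_neg_natAbs (fun j => q ^ min α (α + t - j)),
    ← sum_range_reflect, sum_range_add]
  have h1 : ∀ j ∈ range α,
      q ^ min α (α + t - (α + t - 1 - j + 1)) = q ^ j := fun j hj => by
    rw [mem_range] at hj
    congr 1
    omega
  have h2 : ∀ j ∈ range t,
      q ^ min α (α + t - (α + t - 1 - (α + j) + 1)) = q ^ α := fun j hj => by
    rw [mem_range] at hj
    congr 1
    omega
  rw [sum_congr rfl h1, sum_congr rfl h2]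
  have h0 : min α (α + t - 0) = α := by omega
  push_cast
  rw [h0, geom_sum_eq hq1, sum_const, card_range, nsmul_eq_mul]
  ring


/-- Count of vertices in the intersection of the tube `T_α(A)` around an apartment
and the ball `B_β(v)`, where `δ = d(v,A)` and `a ∈ A` is the nearest vertex to `v`:
it is `0` if `α + β < δ`; it is `|B_α(a) ∩ B_β(v)|` if `β − α ≤ δ ≤ α + β`; and it is
`(1 + 2(β − α − δ))·q^α + 2·(q^α − 1)/(q − 1)` if `δ ≤ β − α`. -/
theorem stmt_7 {V : Type*} (G : SimpleGraph V) (hG : G.IsTree) [Infinite V]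
    (q : ℕ) (hq : 2 ≤ q)
    (hreg : ∀ v : V, (G.neighborSet v).ncard = q + 1)
    (γ : ℤ → V)
    (hadj : ∀ n : ℤ, G.Adj (γ n) (γ (n + 1)))
    (hgeo : ∀ m n : ℤ, G.dist (γ m) (γ n) = (m - n).natAbs)
    (v : V) (δ : ℕ)
    (hδ : sInf ((fun u => G.dist v u) '' Set.range γ) = δ)
    (a : V) (ha : a ∈ Set.range γ) (hav : G.dist a v = δ)
    (α β : ℕ) :
    (α + β < δ →
      {w : V | sInf ((fun u => G.dist w u) '' Set.range γ) ≤ α ∧ G.dist w v ≤ β}.ncard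
        = 0) ∧
    ((β : ℤ) - (α : ℤ) ≤ (δ : ℤ) → δ ≤ α + β →
      {w : V | sInf ((fun u => G.dist w u) '' Set.range γ) ≤ α ∧ G.dist w v ≤ β}.ncard
        = ({w : V | G.dist w a ≤ α} ∩ {w : V | G.dist w v ≤ β}).ncard) ∧
    ((δ : ℤ) ≤ (β : ℤ) - (α : ℤ) →
      ({w : V | sInf ((fun u => G.dist w u) '' Set.range γ) ≤ α ∧ G.dist w v ≤ β}.ncard : ℚ)
        = (1 + 2 * ((β : ℚ) - (α : ℚ) - (δ : ℚ))) * (q : ℚ) ^ α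
          + 2 * ((q : ℚ) ^ α - 1) / ((q : ℚ) - 1)) := by
  obtain ⟨i, rfl⟩ := ha
  rw [SimpleGraph.dist_comm] at hav
  have hv : SimpleGraph.IsFoot G γ i v := by
    obtain ⟨j, hj⟩ := hG.exists_isFoot hadj v
    have hd := hj.sInf_dist_eq hG hadj hgeo
    rwa [hj.eq_of_dist_le hG hadj hgeo (m := i) (by omega)]
  have htri : ∀ w, G.dist w v ≤ G.dist w (γ i) + δ := fun w => by
    have h := hG.connected.dist_triangle (u := w) (v := γ i) (w := v)
    rwa [SimpleGraph.dist_comm (u := γ i), hav] at h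
  have hdist : ∀ w n, SimpleGraph.IsFoot G γ n w → n ≠ i →
      G.dist w v = G.dist w (γ n) + (n - i).natAbs + δ := fun w n hw hn => by
    rw [hw.dist_eq_of_ne hG hadj hgeo hv hn, hav]
  refine ⟨fun h => ?_, fun h1 h2 => ?_, fun h => ?_⟩
  · convert Set.ncard_empty V
    rw [Set.eq_empty_iff_forall_notMem]
    rintro w ⟨hw1, hw2⟩
    obtain ⟨n, hn⟩ := hG.exists_isFoot hadj w
    rw [hn.sInf_dist_eq hG hadj hgeo] at hw1
    have h3 := hG.connected.dist_triangle (u := v) (v := w) (w := γ n)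
    have h4 := hv.dist_eq hG hadj hgeo n
    rw [SimpleGraph.dist_comm (u := v) (v := w)] at h3
    omega
  · congr 1
    ext w
    obtain ⟨n, hn⟩ := hG.exists_isFoot hadj w
    have h3 := hn.dist_eq hG hadj hgeo i
    simp only [Set.mem_inter_iff, Set.mem_ofPred_eq, hn.sInf_dist_eq hG hadj hgeo]
    by_cases hni : n = i
    · rw [hni]
    · have h4 := hdist w n hn hni
      omega
  · obtain ⟨t, ht⟩ : ∃ t : ℕ, β = α + δ + t := ⟨β - α - δ, by omega⟩
    obtain ⟨s, hs, hsc⟩ :=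
      hG.exists_finset_tube_inter_ball (by omega) hreg hadj hgeo i α (α + t)
    have hset : {w : V | sInf ((fun u => G.dist w u) '' Set.range γ) ≤ α ∧ G.dist w v ≤ β}
        = (s : Set V) := by
      ext w
      rw [Set.mem_ofPred_eq, Finset.mem_coe, hs]
      constructor
      · rintro ⟨hw1, hw2⟩
        obtain ⟨n, hn⟩ := hG.exists_isFoot hadj w
        rw [hn.sInf_dist_eq hG hadj hgeo] at hw1
        refine ⟨n - i, ?_⟩
        rw [add_sub_cancel]
        refine ⟨hn, hw1, ?_⟩
        by_cases hni : n = i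
        · subst hni
          simp only [sub_self, Int.natAbs_zero]
          omega
        · have h4 := hdist w n hn hni
          omega
      · rintro ⟨n, hn, hw1, hw2⟩
        rw [hn.sInf_dist_eq hG hadj hgeo]
        refine ⟨hw1, ?_⟩
        have h3 := hn.dist_eq hG hadj hgeo i
        have h4 := htri w
        omega
    rw [hset, Set.ncard_coe_finset, hsc, sum_pow_min_symmetric hq, ht]
    push_cast
    ring
end

section
/- Let q ≥ 2 be an integer, X an infinite (q+1)-regular tree, and A, B two disjoint apartments of X at distance δ = d(A,B) > 0 from each other. Let α, β ≥ 0 be integers. Then the number of vertices in T_α(A) ∩ T_β(B) equals: 0 if α + β < δ; 1 + (q+1)·(q^{(α+β−δ)/2} − 1)/(q − 1) if |α − β| ≤ δ ≤ α + β and α + β + δ is even; 2·(q^{(α+β−δ+1)/2} − 1)/(q − 1) if |α − β| ≤ δ ≤ α + β and α + β + δ is odd; and (1 + 2(|α − β| − δ))·q^{min(α,β)} + 2·(q^{min(α,β)} − 1)/(q − 1) if 0 < δ ≤ |α − β|. -/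
namespace SimpleGraph

variable {V : Type*} {G : SimpleGraph V}

lemma IsTree.eq_of_adj_of_dist_add_one_eq (hG : G.IsTree) {x u u' v : V} (hu : G.Adj u v)
    (hu' : G.Adj u' v) (h : G.dist x u + 1 = G.dist x v) (h' : G.dist x u' + 1 = G.dist x v) :
    u = u' := by
  obtain ⟨p, hp⟩ := hG.connected.exists_walk_length_eq_dist x u
  obtain ⟨p', hp'⟩ := hG.connected.exists_walk_length_eq_dist x u'
  have key : (⟨p.concat hu, Walk.isPath_of_length_eq_dist _ (by simp [hp, h])⟩ : G.Path x v) =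
      ⟨p'.concat hu', Walk.isPath_of_length_eq_dist _ (by simp [hp', h'])⟩ :=
    (hG.isAcyclic.subsingleton_path x v).elim _ _
  exact (Walk.concat_inj (Subtype.ext_iff.mp key)).1

lemma Connected.exists_adj_dist_add_one_eq (hG : G.Connected) {x v : V} (h : 0 < G.dist x v) :
    ∃ u, G.Adj v u ∧ G.dist x u + 1 = G.dist x v := by
  obtain ⟨p, hp⟩ := hG.exists_walk_length_eq_dist v x
  cases p with
  | nil => simp at h
  | @cons _ u _ hadj p =>
    refine ⟨u, hadj, ?_⟩
    have h1 := dist_le p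
    have h2 := hG.dist_triangle (u := v) (v := u) (w := x)
    rw [Walk.length_cons] at hp
    rw [dist_eq_one_iff_adj.mpr hadj] at h2
    rw [dist_comm, dist_comm (u := x)]
    omega

/-- Two geodesics that meet at `w` without backtracking concatenate to a geodesic. -/
lemma IsTree.dist_eq_add_of_adj (hG : G.IsTree) {x z w w' : V} (hadj : G.Adj w w')
    (hz : G.dist z w' + 1 = G.dist z w) (hx : G.dist x w' = G.dist x w + 1) :
    G.dist x z = G.dist x w + G.dist z w := by
  induction hn : G.dist z w' generalizing w w' with
  | zero =>
    obtain rfl := hG.connected.dist_eq_zero_iff.mp hn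
    omega
  | succ n ih =>
    obtain ⟨u, hu, hzu⟩ :=
      hG.connected.exists_adj_dist_add_one_eq (x := z) (v := w') (by omega)
    have hxu : G.dist x u = G.dist x w' + 1 := by
      rcases hG.dist_eq_dist_add_one_of_adj x hu with h | h
      · obtain rfl := hG.eq_of_adj_of_dist_add_one_eq (x := x) hadj hu.symm hx.symm h.symm
        omega
      · exact h
    rw [ih hu hzu hxu (by omega)]
    omega

/-- A vertex of the geodesic from `x` to `y` is determined by its distance to `x`. -/
lemma IsTree.eq_of_dist_add_dist_eq (hG : G.IsTree) {x y w w' : V}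
    (h : G.dist x w + G.dist y w = G.dist x y) (h' : G.dist x w' + G.dist y w' = G.dist x y)
    (hw : G.dist x w = G.dist x w') : w = w' := by
  induction hn : G.dist y w generalizing w w' with
  | zero =>
    have hn' : G.dist y w' = 0 := by omega
    rw [← hG.connected.dist_eq_zero_iff.mp hn, ← hG.connected.dist_eq_zero_iff.mp hn']
  | succ n ih =>
    obtain ⟨u, hu, hyu⟩ := hG.connected.exists_adj_dist_add_one_eq (x := y) (v := w) (by omega)
    obtain ⟨u', hu', hyu'⟩ :=
      hG.connected.exists_adj_dist_add_one_eq (x := y) (v := w') (by omega)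
    have hxu : G.dist x u = G.dist x w + 1 := by
      have := hG.connected.dist_triangle (u := x) (v := u) (w := y)
      have := hG.dist_eq_dist_add_one_of_adj x hu
      rw [dist_comm (u := u)] at *
      omega
    have hxu' : G.dist x u' = G.dist x w' + 1 := by
      have := hG.connected.dist_triangle (u := x) (v := u') (w := y)
      have := hG.dist_eq_dist_add_one_of_adj x hu'
      rw [dist_comm (u := u')] at *
      omega
    obtain rfl := ih (w := u) (w' := u') (by omega) (by omega) (by omega) (by omega)
    exact hG.eq_of_adj_of_dist_add_one_eq hu hu' hxu.symm (by omega)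

/-- In a `(q+1)`-regular tree, a finite set that contains, with each of its vertices, the
geodesic from that vertex to `o` has a closed neighbourhood of size `q * |T| + 2`. -/
lemma IsTree.ncard_closedNeighborhood (hG : G.IsTree) {q : ℕ}
    (hreg : ∀ v : V, (G.neighborSet v).ncard = q + 1) {T : Set V} (hT : T.Finite) {o : V}
    (ho : o ∈ T)
    (hpar : ∀ v ∈ T, ∀ u, G.Adj v u → G.dist o u + 1 = G.dist o v → u ∈ T) :
    {w | w ∈ T ∨ ∃ t ∈ T, G.Adj t w}.Finite ∧
      {w | w ∈ T ∨ ∃ t ∈ T, G.Adj t w}.ncard = q * T.ncard + 2 := by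
  classical
  have hfin : ∀ v, (G.neighborSet v).Finite := fun v =>
    Set.finite_of_ncard_pos (by rw [hreg]; omega)
  let N : V → Finset V := fun v => (hfin v).toFinset
  let C : V → Finset V := fun v => (N v).filter fun u => G.dist o u = G.dist o v + 1
  have hN : ∀ v u, u ∈ N v ↔ G.Adj v u := by simp [N]
  have hNc : ∀ v, (N v).card = q + 1 := fun v => by
    rw [← hreg v, Set.ncard_eq_toFinset_card _ (hfin v)]
  have hC : ∀ v u, u ∈ C v ↔ G.Adj v u ∧ G.dist o u = G.dist o v + 1 := by simp [C, hN]
  have hCo : (C o).card = q + 1 := by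
    rw [← hNc o]
    congr 1
    ext u
    rw [hC, hN, and_iff_left_iff_imp]
    intro h
    rw [dist_self, dist_eq_one_iff_adj.mpr h]
  have hCv : ∀ v, v ≠ o → (C v).card = q := by
    intro v hv
    obtain ⟨p, hp, hd⟩ := hG.connected.exists_adj_dist_add_one_eq
      (hG.connected.pos_dist_of_ne hv.symm)
    have : C v = (N v).erase p := by
      ext u
      rw [hC, Finset.mem_erase, hN]
      constructor
      · rintro ⟨h1, h2⟩
        refine ⟨?_, h1⟩
        rintro rfl
        omega
      · rintro ⟨h1, h2⟩
        refine ⟨h2, ?_⟩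
        rcases hG.dist_eq_dist_add_one_of_adj o h2 with h | h
        · exact absurd (hG.eq_of_adj_of_dist_add_one_eq h2.symm hp.symm h.symm hd) h1
        · exact h
    rw [this, Finset.card_erase_of_mem ((hN _ _).mpr hp), hNc]
    rfl
  obtain ⟨S, rfl⟩ := hT.exists_finset_coe
  have hset : {w | w ∈ (S : Set V) ∨ ∃ t ∈ (S : Set V), G.Adj t w} =
      (insert o (S.biUnion C) : Finset V) := by
    ext w
    simp only [Finset.mem_coe, Set.mem_ofPred_eq, Finset.mem_insert, Finset.mem_biUnion, hC]
    simp only [Finset.mem_coe] at hpar ho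
    constructor
    · intro h
      by_cases hw : w = o
      · exact Or.inl hw
      right
      obtain ⟨p, hp, hd⟩ := hG.connected.exists_adj_dist_add_one_eq
        (hG.connected.pos_dist_of_ne (Ne.symm hw))
      rcases h with h | ⟨t, ht, htw⟩
      · exact ⟨p, hpar w h p hp hd, hp.symm, hd.symm⟩
      · rcases hG.dist_eq_dist_add_one_of_adj o htw with h | h
        · have hw := hpar t ht w htw h.symm
          exact ⟨p, hpar w hw p hp hd, hp.symm, hd.symm⟩
        · exact ⟨t, ht, htw, h⟩
    · rintro (rfl | ⟨t, ht, htw, -⟩)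
      · exact Or.inl ho
      · exact Or.inr ⟨t, ht, htw⟩
  rw [hset]
  refine ⟨Finset.finite_toSet _, ?_⟩
  rw [Set.ncard_coe_finset, Set.ncard_coe_finset, Finset.card_insert_of_notMem,
    Finset.card_biUnion]
  · have : ∀ t ∈ S, (C t).card = q + if o = t then 1 else 0 := by
      intro t _
      split_ifs with h
      · rw [← h, hCo]
      · rw [hCv t (Ne.symm h)]
        rfl
    rw [Finset.sum_congr rfl this, Finset.sum_add_distrib, Finset.sum_ite_eq,
      if_pos (by simpa using ho)]
    simp [mul_comm]
  · intro s _ t _ hst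
    refine Finset.disjoint_left.mpr ?_
    intro u hs ht
    rw [hC] at hs ht
    exact hst (hG.eq_of_adj_of_dist_add_one_eq hs.1 ht.1 hs.2.symm ht.2.symm)
  · simp [hC]

/-- A bi-infinite geodesic. -/
structure IsApartment (G : SimpleGraph V) (γ : ℤ → V) : Prop where
  adj : ∀ n, G.Adj (γ n) (γ (n + 1))
  dist_eq : ∀ m n, G.dist (γ m) (γ n) = (m - n).natAbs

/-- The distance of a vertex to the set of vertices of a bi-infinite path. -/
noncomputable def distTo (G : SimpleGraph V) (γ : ℤ → V) (w : V) : ℕ :=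
  sInf ((fun u => G.dist w u) '' Set.range γ)

lemma distTo_le (γ : ℤ → V) (w : V) (n : ℤ) : G.distTo γ w ≤ G.dist w (γ n) :=
  Nat.sInf_le ⟨_, ⟨n, rfl⟩, rfl⟩

lemma exists_dist_eq_distTo (γ : ℤ → V) (w : V) : ∃ n, G.dist w (γ n) = G.distTo γ w := by
  obtain ⟨_, ⟨n, rfl⟩, h⟩ :=
    Nat.sInf_mem (s := (fun u => G.dist w u) '' Set.range γ) ((Set.range_nonempty γ).image _)
  exact ⟨n, h⟩

/-- The projection of a vertex onto an apartment. -/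
lemma IsApartment.exists_dist_eq_add {γ : ℤ → V} (hγ : G.IsApartment γ) (hG : G.IsTree) (w : V) :
    ∃ p : ℤ, ∀ n, G.dist w (γ n) = G.distTo γ w + (n - p).natAbs := by
  obtain ⟨p, hp⟩ := exists_dist_eq_distTo (G := G) γ w
  have hstep : ∀ n, G.dist w (γ n) = G.dist w (γ (n + 1)) + 1 ∨
      G.dist w (γ (n + 1)) = G.dist w (γ n) + 1 := fun n =>
    hG.dist_eq_dist_add_one_of_adj w (hγ.adj n)
  have hmax : ∀ n, ¬ (G.dist w (γ n) + 1 = G.dist w (γ (n + 1)) ∧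
      G.dist w (γ (n + 1 + 1)) + 1 = G.dist w (γ (n + 1))) := by
    rintro n ⟨h1, h2⟩
    have h := hG.eq_of_adj_of_dist_add_one_eq (hγ.adj n) (hγ.adj (n + 1)).symm h1 h2
    have := hγ.dist_eq n (n + 1 + 1)
    rw [← h, dist_self] at this
    omega
  have hup : ∀ k : ℕ, G.dist w (γ (p + k)) = G.distTo γ w + k ∧
      G.dist w (γ (p + k + 1)) = G.distTo γ w + k + 1 := by
    intro k
    induction k with
    | zero =>
      have := hstep p
      have := distTo_le (G := G) γ w (p + 1)
      simp only [Nat.cast_zero, add_zero]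
      omega
    | succ k ih =>
      have := hstep (p + k + 1)
      have := hmax (p + k)
      push_cast
      rw [← add_assoc]
      omega
  have hdown : ∀ k : ℕ, G.dist w (γ (p - k)) = G.distTo γ w + k ∧
      G.dist w (γ (p - k - 1)) = G.distTo γ w + k + 1 := by
    intro k
    induction k with
    | zero =>
      have := hstep (p - 1)
      have := distTo_le (G := G) γ w (p - 1)
      simp only [Nat.cast_zero, sub_zero, sub_add_cancel] at *
      omega
    | succ k ih =>
      have h1 := hstep (p - k - 1 - 1)
      have h2 := hmax (p - k - 1 - 1)
      push_cast
      rw [← sub_sub]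
      simp only [sub_add_cancel] at h1 h2
      omega
  refine ⟨p, fun n => ?_⟩
  rcases le_total p n with h | h
  · have := (hup (n - p).natAbs).1
    rwa [show p + ((n - p).natAbs : ℤ) = n by omega] at this
  · have := (hdown (n - p).natAbs).1
    rwa [show p - ((n - p).natAbs : ℤ) = n by omega] at this

lemma IsApartment.dist_eq_add_one {γ : ℤ → V} (hγ : G.IsApartment γ) (hG : G.IsTree) {w w' : V}
    (hadj : G.Adj w w') (h : G.distTo γ w' = G.distTo γ w + 1) (n : ℤ) :
    G.dist (γ n) w' = G.dist (γ n) w + 1 := by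
  obtain ⟨p, hp⟩ := hγ.exists_dist_eq_add hG w
  obtain ⟨p', hp'⟩ := hγ.exists_dist_eq_add hG w'
  have h1 := hG.dist_eq_dist_add_one_of_adj (γ p) hadj
  have h2 := hG.dist_eq_dist_add_one_of_adj (γ p') hadj
  simp only [dist_comm (u := γ _), hp, hp'] at h1 h2 ⊢
  omega

lemma Connected.distTo_le_add_one (hG : G.Connected) (γ : ℤ → V) {w w' : V} (hadj : G.Adj w w') :
    G.distTo γ w ≤ G.distTo γ w' + 1 := by
  obtain ⟨n, hn⟩ := exists_dist_eq_distTo (G := G) γ w'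
  have h1 := distTo_le (G := G) γ w n
  have h2 := hG.dist_triangle (u := w) (v := w') (w := γ n)
  rw [dist_eq_one_iff_adj.mpr hadj] at h2
  omega

lemma Connected.exists_adj_distTo_add_one_eq (hG : G.Connected) {γ : ℤ → V} {w : V}
    (h : 0 < G.distTo γ w) : ∃ w', G.Adj w w' ∧ G.distTo γ w' + 1 = G.distTo γ w := by
  obtain ⟨n, hn⟩ := exists_dist_eq_distTo (G := G) γ w
  obtain ⟨w', hadj, hw'⟩ := hG.exists_adj_dist_add_one_eq (x := γ n) (v := w)
    (by rw [dist_comm]; omega)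
  refine ⟨w', hadj, ?_⟩
  have h1 := distTo_le (G := G) γ w' n
  have h2 := hG.distTo_le_add_one γ hadj
  rw [dist_comm, dist_comm (v := w)] at hw'
  omega

lemma IsApartment.distTo_ne_of_adj {γ : ℤ → V} (hγ : G.IsApartment γ) (hG : G.IsTree) {w w' : V}
    (hadj : G.Adj w w') (h : 0 < G.distTo γ w) : G.distTo γ w' ≠ G.distTo γ w := by
  intro heq
  obtain ⟨v, hv, hvw⟩ := hG.connected.exists_adj_distTo_add_one_eq h
  obtain ⟨n, hn⟩ := exists_dist_eq_distTo (G := G) γ w'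
  have h1 := hγ.dist_eq_add_one hG hv.symm hvw.symm n
  have h2 := hG.dist_eq_dist_add_one_of_adj (γ n) hadj
  have h3 := distTo_le (G := G) γ w n
  rw [dist_comm] at hn h3
  obtain rfl := hG.eq_of_adj_of_dist_add_one_eq hv.symm hadj.symm h1.symm (by omega)
  omega

/-- The tubes around an apartment are convex. -/
lemma IsApartment.distTo_le_of_adj {γ : ℤ → V} (hγ : G.IsApartment γ) (hG : G.IsTree) {α : ℕ}
    {o u v : V} (ho : G.distTo γ o ≤ α) (hv : G.distTo γ v ≤ α) (hadj : G.Adj v u)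
    (hu : G.dist o u + 1 = G.dist o v) : G.distTo γ u ≤ α := by
  by_contra hcon
  have h1 := hG.connected.distTo_le_add_one γ hadj.symm
  obtain ⟨n, hn⟩ := exists_dist_eq_distTo (G := G) γ o
  have h2 := hG.dist_eq_add_of_adj hadj hu
    (hγ.dist_eq_add_one hG hadj (by omega) n)
  have h3 := distTo_le (G := G) γ v n
  rw [dist_comm] at hn h3
  omega

lemma IsApartment.dist_eq_add_of_adj {A B : ℤ → V} (hA : G.IsApartment A) (hB : G.IsApartment B)
    (hG : G.IsTree) {w w' : V} (hadj : G.Adj w w') (hwA : G.distTo A w' + 1 = G.distTo A w)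
    (hwB : G.distTo B w' = G.distTo B w + 1) (n m : ℤ) :
    G.dist (A n) (B m) = G.dist (A n) w + G.dist (B m) w := by
  rw [dist_comm, hG.dist_eq_add_of_adj hadj (hA.dist_eq_add_one hG hadj.symm hwA.symm n).symm
    (hB.dist_eq_add_one hG hadj hwB m), add_comm]

/-- The shortest geodesic between `A` and `B` has length `δ` and joins `A i` to `B j`. -/
def IsApartmentBridge (G : SimpleGraph V) (A B : ℤ → V) (i j : ℤ) (δ : ℕ) : Prop :=
  ∀ n m, G.dist (A n) (B m) = (n - i).natAbs + δ + (m - j).natAbs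

lemma IsApartmentBridge.symm {A B : ℤ → V} {i j : ℤ} {δ : ℕ} (h : G.IsApartmentBridge A B i j δ) :
    G.IsApartmentBridge B A j i δ := by
  intro n m
  rw [dist_comm, h]
  omega

lemma IsApartment.isApartmentBridge {A B : ℤ → V} (hA : G.IsApartment A) (hB : G.IsApartment B)
    (hG : G.IsTree) {i j : ℤ} {δ : ℕ} (hδpos : 0 < δ) (hδ : G.dist (A i) (B j) = δ)
    (hmin : ∀ n m, δ ≤ G.dist (A n) (B m)) : G.IsApartmentBridge A B i j δ := by
  have hminB : ∀ n, δ ≤ G.distTo B (A n) := by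
    intro n
    obtain ⟨m, hm⟩ := exists_dist_eq_distTo (G := G) B (A n)
    rw [← hm]
    exact hmin n m
  have hAi : G.distTo A (A i) = 0 := by
    have := distTo_le (G := G) A (A i) i
    rw [dist_self] at this
    omega
  have hBi : G.distTo B (A i) = δ :=
    le_antisymm ((distTo_le B (A i) j).trans hδ.le) (hminB i)
  obtain ⟨w, hw, hwB⟩ :=
    hG.connected.exists_adj_distTo_add_one_eq (γ := B) (w := A i) (by omega)
  have hwA : G.distTo A w = G.distTo A (A i) + 1 := by
    have h1 := hG.connected.distTo_le_add_one A hw.symm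
    have h2 : G.distTo A w ≠ 0 := by
      intro h0
      obtain ⟨n, hn⟩ := exists_dist_eq_distTo (G := G) A w
      rw [h0, hG.connected.dist_eq_zero_iff] at hn
      have := hminB n
      rw [← hn] at this
      omega
    omega
  obtain ⟨p, hp⟩ := hB.exists_dist_eq_add hG (A i)
  intro n m
  have h1 := hB.dist_eq_add_of_adj hA hG hw hwB hwA m n
  have h2 := hp j
  rw [dist_comm, h1, hA.dist_eq, dist_comm, hp, hBi]
  omega

/-- The intersection of the tube of radius `α` around `A` with that of radius `β` around `B`. -/
def tubeInter (G : SimpleGraph V) (A B : ℤ → V) (α β : ℕ) : Set V :=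
  {w | G.distTo A w ≤ α ∧ G.distTo B w ≤ β}

lemma tubeInter_comm (A B : ℤ → V) (α β : ℕ) :
    G.tubeInter A B α β = G.tubeInter B A β α :=
  Set.ext fun _ => and_comm

section Bridge

variable {A B : ℤ → V} {i j : ℤ} {δ α β : ℕ}

lemma IsApartmentBridge.le_distTo_add (h : G.IsApartmentBridge A B i j δ) (hG : G.Connected) (w : V) :
    δ ≤ G.distTo A w + G.distTo B w := by
  obtain ⟨n, hn⟩ := exists_dist_eq_distTo (G := G) A w
  obtain ⟨m, hm⟩ := exists_dist_eq_distTo (G := G) B w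
  have := hG.dist_triangle (u := A n) (v := w) (w := B m)
  rw [h, dist_comm] at this
  omega

lemma IsApartmentBridge.exists_adj_distTo_le (h : G.IsApartmentBridge A B i j δ) (hG : G.IsTree)
    (hA : G.IsApartment A) (hB : G.IsApartment B) {w : V} (hw : 0 < G.distTo A w)
    (hδ : δ < G.distTo A w + G.distTo B w) :
    ∃ w', G.Adj w w' ∧ G.distTo A w' + 1 = G.distTo A w ∧
      G.distTo B w' ≤ G.distTo B w - 1 := by
  obtain ⟨w', hadj, hw'⟩ := hG.connected.exists_adj_distTo_add_one_eq hw
  refine ⟨w', hadj, hw', ?_⟩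
  by_contra hcon
  have h1 := hG.connected.distTo_le_add_one B hadj.symm
  have h2 := hB.distTo_ne_of_adj hG hadj
  have h3 := hA.dist_eq_add_of_adj hB hG hadj hw' (by omega) i j
  have h4 := distTo_le (G := G) A w i
  have h5 := distTo_le (G := G) B w j
  rw [h, sub_self, sub_self, dist_comm, dist_comm (v := w)] at h3
  simp only [Int.natAbs_zero] at h3
  omega

lemma IsApartmentBridge.tubeInter_succ (h : G.IsApartmentBridge A B i j δ) (hG : G.IsTree)
    (hA : G.IsApartment A) (hB : G.IsApartment B) (hδ : δ ≤ α + β) :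
    G.tubeInter A B (α + 1) (β + 1) =
      {w | w ∈ G.tubeInter A B α β ∨ ∃ t ∈ G.tubeInter A B α β, G.Adj t w} := by
  have key : ∀ {A B : ℤ → V} {i j : ℤ} {α β : ℕ}, G.IsApartmentBridge A B i j δ → G.IsApartment A →
      G.IsApartment B → δ ≤ α + β → ∀ w, G.distTo A w = α + 1 → G.distTo B w ≤ β + 1 →
      ∃ t, G.distTo A t ≤ α ∧ G.distTo B t ≤ β ∧ G.Adj t w := by
    intro A B i j α β h hA hB hδ w hwA hwB
    by_cases hs : δ < G.distTo A w + G.distTo B w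
    · obtain ⟨w', hadj, h1, h2⟩ := h.exists_adj_distTo_le hG hA hB (by omega) hs
      exact ⟨w', by omega, by omega, hadj.symm⟩
    · obtain ⟨w', hadj, h1⟩ :=
        hG.connected.exists_adj_distTo_add_one_eq (γ := A) (w := w) (by omega)
      have h2 := hG.connected.distTo_le_add_one B hadj.symm
      exact ⟨w', by omega, by omega, hadj.symm⟩
  ext w
  simp only [tubeInter, Set.mem_ofPred_eq]
  constructor
  · rintro ⟨h1, h2⟩
    by_cases hwA : G.distTo A w ≤ α
    · by_cases hwB : G.distTo B w ≤ β
      · exact Or.inl ⟨hwA, hwB⟩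
      · obtain ⟨t, ht, ht', hadj⟩ := key (α := β) (β := α) h.symm hB hA (by omega) w (by omega) h1
        exact Or.inr ⟨t, ⟨ht', ht⟩, hadj⟩
    · obtain ⟨t, ht, ht', hadj⟩ := key h hA hB hδ w (by omega) h2
      exact Or.inr ⟨t, ⟨ht, ht'⟩, hadj⟩
  · rintro (⟨h1, h2⟩ | ⟨t, ⟨h1, h2⟩, hadj⟩)
    · exact ⟨by omega, by omega⟩
    · have := hG.connected.distTo_le_add_one A hadj.symm
      have := hG.connected.distTo_le_add_one B hadj.symm
      exact ⟨by omega, by omega⟩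

lemma IsApartmentBridge.ncard_tubeInter_succ (h : G.IsApartmentBridge A B i j δ) (hG : G.IsTree)
    (hA : G.IsApartment A) (hB : G.IsApartment B) (hδ : δ ≤ α + β) {q : ℕ}
    (hreg : ∀ v : V, (G.neighborSet v).ncard = q + 1) (hpos : 0 < (G.tubeInter A B α β).ncard) :
    (G.tubeInter A B (α + 1) (β + 1)).ncard = q * (G.tubeInter A B α β).ncard + 2 := by
  rw [h.tubeInter_succ hG hA hB hδ]
  obtain ⟨o, ho⟩ := Set.nonempty_of_ncard_ne_zero hpos.ne'
  refine (hG.ncard_closedNeighborhood hreg (Set.finite_of_ncard_pos hpos) ho ?_).2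
  exact fun v hv u hadj hu => ⟨hA.distTo_le_of_adj hG ho.1 hv.1 hadj hu,
    hB.distTo_le_of_adj hG ho.2 hv.2 hadj hu⟩

lemma IsApartmentBridge.ncard_tubeInter_add (h : G.IsApartmentBridge A B i j δ) (hG : G.IsTree)
    (hA : G.IsApartment A) (hB : G.IsApartment B) (hδ : δ ≤ α + β) {q : ℕ} (hq : 2 ≤ q)
    (hreg : ∀ v : V, (G.neighborSet v).ncard = q + 1) (hpos : 0 < (G.tubeInter A B α β).ncard)
    (r : ℕ) :
    ((G.tubeInter A B (α + r) (β + r)).ncard : ℚ) =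
      (G.tubeInter A B α β).ncard * (q : ℚ) ^ r + 2 * ((q : ℚ) ^ r - 1) / ((q : ℚ) - 1) := by
  have hq1 : (q : ℚ) - 1 ≠ 0 := by
    have : (2 : ℚ) ≤ q := by exact_mod_cast hq
    linarith
  have key : 0 < (G.tubeInter A B (α + r) (β + r)).ncard ∧
      ((G.tubeInter A B (α + r) (β + r)).ncard : ℚ) =
      (G.tubeInter A B α β).ncard * (q : ℚ) ^ r + 2 * ((q : ℚ) ^ r - 1) / ((q : ℚ) - 1) := by
    induction r with
    | zero => simpa using hpos
    | succ r ih =>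
      have := h.ncard_tubeInter_succ (α := α + r) (β := β + r) hG hA hB (by omega) hreg ih.1
      rw [← add_assoc, ← add_assoc, this]
      refine ⟨by omega, ?_⟩
      push_cast
      rw [ih.2]
      field_simp
      ring
  exact key.2

lemma Connected.exists_dist_eq (hG : G.Connected) {x y : V} {k : ℕ} (hk : k ≤ G.dist x y) :
    ∃ w, G.dist x w = k ∧ G.dist x w + G.dist y w = G.dist x y := by
  induction k with
  | zero => exact ⟨x, dist_self, by rw [dist_self, zero_add, dist_comm]⟩
  | succ k ih =>
    obtain ⟨w, hw, hwy⟩ := ih (by omega)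
    obtain ⟨u, hadj, hu⟩ := hG.exists_adj_dist_add_one_eq (x := y) (v := w) (by omega)
    have h1 := hG.dist_triangle (u := x) (v := w) (w := u)
    have h2 := hG.dist_triangle (u := x) (v := u) (w := y)
    rw [dist_eq_one_iff_adj.mpr hadj] at h1
    rw [dist_comm (u := u)] at h2
    exact ⟨u, by omega, by omega⟩

lemma IsApartmentBridge.exists_tubeInter_eq_singleton (h : G.IsApartmentBridge A B i j δ) (hG : G.IsTree)
    (hδ : α + β = δ) : ∃ v, G.tubeInter A B α β = {v} := by
  have hij : G.dist (A i) (B j) = δ := by simp [h i j]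
  obtain ⟨v, hv, hvB⟩ :=
    hG.connected.exists_dist_eq (x := A i) (y := B j) (k := α) (by omega)
  refine ⟨v, Set.eq_singleton_iff_unique_mem.mpr ⟨⟨?_, ?_⟩, ?_⟩⟩
  · rw [← hv, dist_comm]
    exact distTo_le A v i
  · have := distTo_le (G := G) B v j
    rw [dist_comm] at this
    omega
  · rintro w ⟨hwA, hwB⟩
    obtain ⟨n, hn⟩ := exists_dist_eq_distTo (G := G) A w
    obtain ⟨m, hm⟩ := exists_dist_eq_distTo (G := G) B w
    have h1 := hG.connected.dist_triangle (u := A n) (v := w) (w := B m)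
    have h2 := h n m
    rw [dist_comm] at hn
    obtain rfl : n = i := by omega
    obtain rfl : m = j := by omega
    rw [dist_comm] at hm
    rw [dist_comm (u := w)] at h1
    exact hG.eq_of_dist_add_dist_eq (x := A n) (y := B m) (by omega) (by omega) (by omega)

lemma IsApartmentBridge.ncard_tubeInter_eq_two (h : G.IsApartmentBridge A B i j δ) (hG : G.IsTree)
    (hA : G.IsApartment A) (hB : G.IsApartment B) (hδ : α + β + 1 = δ) :
    (G.tubeInter A B (α + 1) (β + 1)).ncard = 2 := by
  obtain ⟨u, hu⟩ := h.exists_tubeInter_eq_singleton (α := α) (β := β + 1) hG (by omega)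
  obtain ⟨v, hv⟩ := h.exists_tubeInter_eq_singleton (α := α + 1) (β := β) hG (by omega)
  have hu' : u ∈ G.tubeInter A B α (β + 1) := by rw [hu]; rfl
  have hv' : v ∈ G.tubeInter A B (α + 1) β := by rw [hv]; rfl
  have huv : u ≠ v := by
    rintro rfl
    have := h.le_distTo_add hG.connected u
    have := hu'.1
    have := hv'.2
    omega
  rw [← Set.ncard_pair huv]
  congr 1
  ext w
  rw [Set.mem_insert_iff, ← Set.mem_singleton_iff, ← hu, ← hv]
  constructor
  · rintro ⟨h1, h2⟩
    by_contra! hcon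
    have h3 : ¬ (G.distTo A w ≤ α ∧ G.distTo B w ≤ β + 1) := hcon.1
    have h4 : ¬ (G.distTo A w ≤ α + 1 ∧ G.distTo B w ≤ β) := hcon.2
    obtain ⟨w', -, h5, h6⟩ := h.exists_adj_distTo_le hG hA hB (w := w) (by omega) (by omega)
    have := h.le_distTo_add hG.connected w'
    omega
  · rintro (⟨h1, h2⟩ | ⟨h1, h2⟩)
    · exact ⟨by omega, h2⟩
    · exact ⟨h1, by omega⟩

lemma IsApartmentBridge.ncard_tubeInter_zero (h : G.IsApartmentBridge A B i j δ) (hG : G.IsTree)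
    (hB : G.IsApartment B) (l : ℕ) : (G.tubeInter A B (δ + l) 0).ncard = 2 * l + 1 := by
  have hdist : ∀ m, G.distTo A (B m) = δ + (m - j).natAbs := by
    intro m
    obtain ⟨n, hn⟩ := exists_dist_eq_distTo (G := G) A (B m)
    have h1 := distTo_le (G := G) A (B m) i
    rw [h.symm] at hn h1
    omega
  have hinj : Function.Injective B := by
    intro m n hmn
    have := hB.dist_eq m n
    rw [hmn, dist_self] at this
    omega
  have hset : G.tubeInter A B (δ + l) 0 = B '' (Finset.Icc (j - l) (j + l) : Finset ℤ) := by
    ext w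
    simp only [tubeInter, Set.mem_ofPred_eq, Set.mem_image, Finset.coe_Icc, Set.mem_Icc]
    constructor
    · rintro ⟨h1, h2⟩
      obtain ⟨m, hm⟩ := exists_dist_eq_distTo (G := G) B w
      rw [Nat.le_zero.mp h2, hG.connected.dist_eq_zero_iff] at hm
      subst hm
      rw [hdist] at h1
      exact ⟨m, by omega, rfl⟩
    · rintro ⟨m, hm, rfl⟩
      have := distTo_le (G := G) B (B m) m
      rw [dist_self] at this
      exact ⟨by rw [hdist]; omega, this⟩
  rw [hset, Set.ncard_image_of_injective _ hinj, Set.ncard_coe_finset, Int.card_Icc]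
  omega

/-- The count when the difference of the radii is at least the distance of the apartments. -/
lemma IsApartmentBridge.ncard_tubeInter_of_add_le (h : G.IsApartmentBridge A B i j δ) (hG : G.IsTree)
    (hA : G.IsApartment A) (hB : G.IsApartment B) {q : ℕ} (hq : 2 ≤ q)
    (hreg : ∀ v : V, (G.neighborSet v).ncard = q + 1) (hle : β + δ ≤ α) :
    ((G.tubeInter A B α β).ncard : ℚ) =
      (1 + 2 * ((α : ℚ) - β - δ)) * (q : ℚ) ^ β + 2 * ((q : ℚ) ^ β - 1) / ((q : ℚ) - 1) := by
  obtain ⟨l, rfl⟩ := Nat.exists_eq_add_of_le hle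
  have h0 := h.ncard_tubeInter_zero hG hB l
  have h1 := h.ncard_tubeInter_add (α := δ + l) (β := 0) hG hA hB (by omega) hq hreg
    (by omega) β
  rw [h0, zero_add, show δ + l + β = β + δ + l by omega] at h1
  rw [h1]
  push_cast
  ring

end Bridge

end SimpleGraph


/-- Count of vertices in the intersection of the tubes `T_α(A)` and `T_β(B)` around
two disjoint apartments at distance `δ > 0`:
`0` if `α + β < δ`;
`1 + (q+1)·(q^{(α+β−δ)/2} − 1)/(q−1)` if `|α−β| ≤ δ ≤ α+β` and `α+β+δ` is even;
`2·(q^{(α+β−δ+1)/2} − 1)/(q−1)` if `|α−β| ≤ δ ≤ α+β` and `α+β+δ` is odd;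
`(1 + 2(|α−β| − δ))·q^{min(α,β)} + 2·(q^{min(α,β)} − 1)/(q−1)` if `0 < δ ≤ |α−β|`. -/
theorem stmt_8 {V : Type*} (G : SimpleGraph V) (hG : G.IsTree) [Infinite V]
    (q : ℕ) (hq : 2 ≤ q)
    (hreg : ∀ v : V, (G.neighborSet v).ncard = q + 1)
    (γA γB : ℤ → V)
    (hadjA : ∀ n : ℤ, G.Adj (γA n) (γA (n + 1)))
    (hgeoA : ∀ m n : ℤ, G.dist (γA m) (γA n) = (m - n).natAbs)
    (hadjB : ∀ n : ℤ, G.Adj (γB n) (γB (n + 1)))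
    (hgeoB : ∀ m n : ℤ, G.dist (γB m) (γB n) = (m - n).natAbs)
    (hdisj : Disjoint (Set.range γA) (Set.range γB))
    (δ : ℕ) (hδpos : 0 < δ)
    (hδ : sInf (Set.image2 G.dist (Set.range γA) (Set.range γB)) = δ)
    (α β : ℕ) :
    (α + β < δ →
      {w : V | sInf ((fun u => G.dist w u) '' Set.range γA) ≤ α ∧
          sInf ((fun u => G.dist w u) '' Set.range γB) ≤ β}.ncard = 0) ∧
    (((α : ℤ) - β).natAbs ≤ δ →
      ∀ k : ℕ, α + β = δ + 2 * k →
        ({w : V | sInf ((fun u => G.dist w u) '' Set.range γA) ≤ α ∧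
            sInf ((fun u => G.dist w u) '' Set.range γB) ≤ β}.ncard : ℚ)
          = 1 + (q + 1 : ℚ) * ((q : ℚ) ^ k - 1) / ((q : ℚ) - 1)) ∧
    (((α : ℤ) - β).natAbs ≤ δ → δ ≤ α + β →
      ∀ k : ℕ, α + β + 1 = δ + 2 * k →
        ({w : V | sInf ((fun u => G.dist w u) '' Set.range γA) ≤ α ∧
            sInf ((fun u => G.dist w u) '' Set.range γB) ≤ β}.ncard : ℚ)
          = 2 * ((q : ℚ) ^ k - 1) / ((q : ℚ) - 1)) ∧
    (δ ≤ ((α : ℤ) - β).natAbs →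
      ({w : V | sInf ((fun u => G.dist w u) '' Set.range γA) ≤ α ∧
          sInf ((fun u => G.dist w u) '' Set.range γB) ≤ β}.ncard : ℚ)
        = (1 + 2 * (((((α : ℤ) - β).natAbs : ℚ)) - (δ : ℚ))) * (q : ℚ) ^ (min α β)
          + 2 * ((q : ℚ) ^ (min α β) - 1) / ((q : ℚ) - 1)) := by
  have hA : G.IsApartment γA := ⟨hadjA, hgeoA⟩
  have hB : G.IsApartment γB := ⟨hadjB, hgeoB⟩
  obtain ⟨i, j, h⟩ : ∃ i j, G.IsApartmentBridge γA γB i j δ := by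
    have hne : (Set.image2 G.dist (Set.range γA) (Set.range γB)).Nonempty :=
      (Set.range_nonempty γA).image2 (Set.range_nonempty γB)
    obtain ⟨_, ⟨i, rfl⟩, _, ⟨j, rfl⟩, hij⟩ := Nat.sInf_mem hne
    refine ⟨i, j, hA.isApartmentBridge hB hG hδpos (hij.trans hδ) fun n m => ?_⟩
    rw [← hδ]
    exact Nat.sInf_le ⟨_, ⟨n, rfl⟩, _, ⟨m, rfl⟩, rfl⟩
  have hq1 : (q : ℚ) - 1 ≠ 0 := by
    have : (2 : ℚ) ≤ q := by exact_mod_cast hq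
    linarith
  change (α + β < δ → (G.tubeInter γA γB α β).ncard = 0) ∧
    (_ → ∀ k : ℕ, _ → ((G.tubeInter γA γB α β).ncard : ℚ) = _) ∧
    (_ → _ → ∀ k : ℕ, _ → ((G.tubeInter γA γB α β).ncard : ℚ) = _) ∧
    (_ → ((G.tubeInter γA γB α β).ncard : ℚ) = _)
  refine ⟨fun hlt => ?_, fun hle k hk => ?_, fun hle hδle k hk => ?_, fun hle => ?_⟩
  · suffices G.tubeInter γA γB α β = ∅ by rw [this, Set.ncard_empty]
    refine Set.eq_empty_of_forall_notMem fun w hw => ?_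
    have := h.le_distTo_add hG.connected w
    have := hw.1
    have := hw.2
    omega
  · obtain ⟨a, rfl⟩ := Nat.exists_eq_add_of_le' (show k ≤ α by omega)
    obtain ⟨b, rfl⟩ := Nat.exists_eq_add_of_le' (show k ≤ β by omega)
    obtain ⟨v, hv⟩ := h.exists_tubeInter_eq_singleton (α := a) (β := b) hG (by omega)
    have hc : (G.tubeInter γA γB a b).ncard = 1 := by rw [hv, Set.ncard_singleton]
    rw [h.ncard_tubeInter_add hG hA hB (by omega) hq hreg (by omega), hc]
    field_simp
    ring
  · obtain ⟨r, rfl⟩ := Nat.exists_eq_add_of_le' (show 1 ≤ k by omega)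
    obtain ⟨a, rfl⟩ := Nat.exists_eq_add_of_le' (show r + 1 ≤ α by omega)
    obtain ⟨b, rfl⟩ := Nat.exists_eq_add_of_le' (show r + 1 ≤ β by omega)
    have hc := h.ncard_tubeInter_eq_two (α := a) (β := b) hG hA hB (by omega)
    rw [add_comm r 1, ← add_assoc, ← add_assoc,
      h.ncard_tubeInter_add hG hA hB (by omega) hq hreg (by omega), hc]
    field_simp
    ring
  · rcases le_total β α with hβ | hα
    · rw [h.ncard_tubeInter_of_add_le hG hA hB hq hreg (by omega), min_eq_right hβ,
        Nat.cast_natAbs, abs_of_nonneg (by omega)]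
      push_cast
      ring
    · rw [SimpleGraph.tubeInter_comm, h.symm.ncard_tubeInter_of_add_le hG hB hA hq hreg (by omega),
        min_eq_left hα, Nat.cast_natAbs, abs_of_nonpos (by omega)]
      push_cast
      ring
end

section
/- Let q ≥ 2 be an integer, X an infinite (q+1)-regular tree, and A, B two distinct apartments of X whose intersection A ∩ B is finite and nonempty, consisting of r ≥ 1 vertices. Let α, β ≥ 0 be integers. Then the number of vertices in T_α(A) ∩ T_β(B) equals (r + 2·|α − β|)·q^{min(α,β)} + 2·(q^{min(α,β)} − 1)/(q − 1). -/
namespace SimpleGraph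

variable {V : Type*} {G : SimpleGraph V}

lemma IsTree.eq_of_adj_of_dist_eq (hG : G.IsTree) {u x y z : V} (hy : G.Adj x y) (hz : G.Adj x z)
    (hdy : G.dist u x = G.dist u y + 1) (hdz : G.dist u x = G.dist u z + 1) : y = z := by
  obtain ⟨p, -, hp⟩ := hG.connected.exists_path_of_dist u y
  obtain ⟨p', -, hp'⟩ := hG.connected.exists_path_of_dist u z
  have h₁ : (p.concat hy.symm).IsPath :=
    Walk.isPath_of_length_eq_dist _ (by rw [Walk.length_concat, hp, hdy])
  have h₂ : (p'.concat hz.symm).IsPath :=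
    Walk.isPath_of_length_eq_dist _ (by rw [Walk.length_concat, hp', hdz])
  have h := (hG.existsUnique_path u x).unique h₁ h₂
  simpa using congrArg Walk.penultimate h

lemma Connected.exists_adj_dist_eq (hG : G.Connected) {u x : V} (h : u ≠ x) :
    ∃ y, G.Adj x y ∧ G.dist u x = G.dist u y + 1 := by
  obtain ⟨p, hp⟩ := hG.exists_walk_length_eq_dist x u
  cases p with
  | nil => exact absurd rfl h
  | @cons _ y _ hxy p =>
    refine ⟨y, hxy, ?_⟩
    have h₁ := G.dist_le p
    have h₂ := hG.dist_triangle (u := x) (v := y) (w := u)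
    rw [dist_eq_one_iff_adj.2 hxy] at h₂
    rw [Walk.length_cons] at hp
    rw [G.dist_comm (u := u) (v := x), G.dist_comm (u := u) (v := y)]
    omega

/-- A walk without backtracking whose first step leads away from `u` keeps leading away. -/
lemma IsTree.dist_eq_add_of_nonbacktracking (hG : G.IsTree) {u : V} (δ : ℕ → V)
    (hadj : ∀ n, G.Adj (δ n) (δ (n + 1))) (hne : ∀ n, δ n ≠ δ (n + 2))
    (h : G.dist u (δ 1) = G.dist u (δ 0) + 1) (n : ℕ) :
    G.dist u (δ n) = G.dist u (δ 0) + n := by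
  have step : ∀ n, G.dist u (δ (n + 1)) = G.dist u (δ n) + 1 := by
    intro n
    induction n with
    | zero => exact h
    | succ n ih =>
      refine (hG.dist_eq_dist_add_one_of_adj u (hadj (n + 1))).resolve_left fun h' ↦ ?_
      exact hne n (hG.eq_of_adj_of_dist_eq (hadj n).symm (hadj (n + 1)) ih h')
  induction n with
  | zero => rfl
  | succ n ih => rw [step, ih, add_assoc]

/-- A map `ℤ → V` is a bi-infinite geodesic. -/
structure IsGeodesicLine (G : SimpleGraph V) (γ : ℤ → V) : Prop where
  adj : ∀ n : ℤ, G.Adj (γ n) (γ (n + 1))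
  dist_eq : ∀ m n : ℤ, G.dist (γ m) (γ n) = (m - n).natAbs

namespace IsGeodesicLine

variable {γ : ℤ → V}

lemma injective (hγ : G.IsGeodesicLine γ) : Function.Injective γ := by
  intro m n h
  have := hγ.dist_eq m n
  rw [h, dist_self] at this
  omega

lemma dist_eq_add (hG : G.IsTree) (hγ : G.IsGeodesicLine γ) {u : V} {c : ℤ}
    (h₁ : G.dist u (γ (c + 1)) = G.dist u (γ c) + 1)
    (h₂ : G.dist u (γ (c - 1)) = G.dist u (γ c) + 1) (m : ℤ) :
    G.dist u (γ m) = G.dist u (γ c) + (m - c).natAbs := by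
  rcases le_total c m with h | h
  · have := hG.dist_eq_add_of_nonbacktracking (u := u) (fun n : ℕ ↦ γ (c + n))
      (fun n ↦ by simpa [add_assoc] using hγ.adj (c + n))
      (fun n h ↦ by have := hγ.injective h; grind) (by simpa using h₁) (m - c).natAbs
    rw [show c + ((m - c).natAbs : ℤ) = m by omega] at this
    simpa using this
  · have := hG.dist_eq_add_of_nonbacktracking (u := u) (fun n : ℕ ↦ γ (c - n))
      (fun n ↦ by
        have := (hγ.adj (c - n - 1)).symm
        rw [sub_add_cancel] at this
        simpa [sub_sub] using this)
      (fun n h ↦ by have := hγ.injective h; grind) (by simpa using h₂) (m - c).natAbs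
    rw [show c - ((m - c).natAbs : ℤ) = m by omega] at this
    simpa using this

lemma exists_dist_eq_add (hG : G.IsTree) (hγ : G.IsGeodesicLine γ) (u : V) :
    ∃ c, ∀ m, G.dist u (γ m) = G.dist u (γ c) + (m - c).natAbs := by
  let f : ℤ → ℕ := fun n ↦ G.dist u (γ n)
  let c := Function.argmin f
  have hc : ∀ n, G.dist u (γ c) ≤ G.dist u (γ n) := fun n ↦ Function.argmin_le f n
  refine ⟨c, hγ.dist_eq_add hG ?_ ?_⟩
  · have := hG.dist_eq_dist_add_one_of_adj u (hγ.adj c)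
    have := hc (c + 1)
    omega
  · have := hG.dist_eq_dist_add_one_of_adj u (hγ.adj (c - 1))
    rw [sub_add_cancel] at this
    have := hc (c - 1)
    omega

/-- If the neighbour of `γ c` towards `u` is not on the line, then `γ c` is the point of the line
closest to `u`. -/
lemma dist_eq_add_of_adj_notMem (hG : G.IsTree) (hγ : G.IsGeodesicLine γ) {u y : V} {c : ℤ}
    (hadj : G.Adj (γ c) y) (hd : G.dist u (γ c) = G.dist u y + 1) (hy : y ∉ Set.range γ) (m : ℤ) :
    G.dist u (γ m) = G.dist u (γ c) + (m - c).natAbs := by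
  refine hγ.dist_eq_add hG ?_ ?_ m
  · refine (hG.dist_eq_dist_add_one_of_adj u (hγ.adj c)).resolve_left fun h ↦ hy ?_
    exact ⟨_, hG.eq_of_adj_of_dist_eq (hγ.adj c) hadj h hd⟩
  · have h := hγ.adj (c - 1)
    rw [sub_add_cancel] at h
    refine (hG.dist_eq_dist_add_one_of_adj u h).resolve_right fun h' ↦ hy ?_
    exact ⟨_, hG.eq_of_adj_of_dist_eq h.symm hadj h' hd⟩

end IsGeodesicLine

/-- The vertices at distance `k` from `v` whose geodesic to `v` avoids the neighbours `v₁`, `v₂`. -/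
def branchSphere (G : SimpleGraph V) (v v₁ v₂ : V) (k : ℕ) : Set V :=
  {w | G.dist v w = k ∧ G.dist v₁ w = k + 1 ∧ G.dist v₂ w = k + 1}

/-- The vertices at distance at most `k` from `v` whose geodesic to `v` avoids `v₁`, `v₂`. -/
def branchBall (G : SimpleGraph V) (v v₁ v₂ : V) (k : ℕ) : Set V :=
  {w | G.dist v w ≤ k ∧ G.dist v₁ w = G.dist v w + 1 ∧ G.dist v₂ w = G.dist v w + 1}

variable {q : ℕ} {v v₁ v₂ : V}

lemma branchBall_succ (k : ℕ) :
    G.branchBall v v₁ v₂ (k + 1) = G.branchBall v v₁ v₂ k ∪ G.branchSphere v v₁ v₂ (k + 1) := by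
  ext w
  simp only [branchBall, branchSphere, Set.mem_ofPred_eq, Set.mem_union]
  omega

lemma disjoint_branchBall_branchSphere (k : ℕ) :
    Disjoint (G.branchBall v v₁ v₂ k) (G.branchSphere v v₁ v₂ (k + 1)) := by
  rw [Set.disjoint_left]
  simp only [branchBall, branchSphere, Set.mem_ofPred_eq]
  omega

lemma branchSphere_zero (hG : G.IsTree) (h₁ : G.Adj v v₁) (h₂ : G.Adj v v₂) :
    G.branchSphere v v₁ v₂ 0 = {v} := by
  ext w
  simp only [branchSphere, Set.mem_ofPred_eq, Set.mem_singleton_iff, hG.connected.dist_eq_zero_iff]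
  constructor
  · rintro ⟨rfl, -⟩; rfl
  · rintro rfl
    exact ⟨rfl, by simpa using h₁.symm, by simpa using h₂.symm⟩

/-- A step away from `v` does not step towards a neighbour `v'` of `v`, unless at `v`. -/
lemma IsTree.dist_eq_of_adj_of_ne (hG : G.IsTree) {v' w w' : V} (hv : G.Adj v v') (hw : G.Adj w w')
    (hvw : v ≠ w) (hd : G.dist v w' = G.dist v w + 1) (h : G.dist v' w = G.dist v w + 1) :
    G.dist v' w' = G.dist v w' + 1 := by
  obtain ⟨p, hp, hdp⟩ := hG.connected.exists_adj_dist_eq hvw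
  rcases hG.dist_eq_dist_add_one_of_adj v' hw with h' | h'
  · have h₁ := hG.connected.dist_triangle (u := v') (v := v) (w := p)
    rw [dist_eq_one_iff_adj.2 hv.symm] at h₁
    have h₂ := hG.dist_eq_dist_add_one_of_adj v' hp
    have := hG.eq_of_adj_of_dist_eq hw hp h' (by omega)
    subst this
    omega
  · omega

lemma ncard_children_branchSphere (hG : G.IsTree) (hreg : ∀ v, (G.neighborSet v).ncard = q + 1)
    (h₁ : G.Adj v v₁) (h₂ : G.Adj v v₂) (h₁₂ : v₁ ≠ v₂) {k : ℕ} {w : V}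
    (hw : w ∈ G.branchSphere v v₁ v₂ k) :
    (G.neighborSet w ∩ G.branchSphere v v₁ v₂ (k + 1)).ncard = if k = 0 then q - 1 else q := by
  split_ifs with hk
  · subst hk
    obtain rfl : w = v := by rwa [branchSphere_zero hG h₁ h₂] at hw
    have : G.neighborSet w ∩ G.branchSphere w v₁ v₂ (0 + 1) = G.neighborSet w \ {v₁, v₂} := by
      ext x
      simp only [branchSphere, Set.mem_inter_iff, mem_neighborSet, Set.mem_ofPred_eq, Set.mem_sdiff,
        Set.mem_insert_iff, Set.mem_singleton_iff]
      refine and_congr_right fun hx ↦ ?_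
      have key : ∀ v', G.Adj w v' → (G.dist v' x = 2 ↔ x ≠ v') := by
        intro v' hv'
        have h := hG.dist_eq_dist_add_one_of_adj v' hx
        rw [dist_eq_one_iff_adj.2 hv'.symm] at h
        have := hG.connected.dist_eq_zero_iff (u := v') (v := x)
        rw [ne_comm, ne_eq, ← this]
        omega
      rw [dist_eq_one_iff_adj.2 hx]
      simp [key _ h₁, key _ h₂]
    rw [this, Set.ncard_sdiff (by simp [Set.insert_subset_iff, h₁, h₂]), hreg,
      Set.ncard_pair h₁₂]
    rfl
  · obtain ⟨hd, hd₁, hd₂⟩ := hw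
    have hvw : v ≠ w := by rintro rfl; simp at hd; omega
    obtain ⟨p, hp, hdp⟩ := hG.connected.exists_adj_dist_eq hvw
    have : G.neighborSet w ∩ G.branchSphere v v₁ v₂ (k + 1) = G.neighborSet w \ {p} := by
      ext x
      simp only [branchSphere, Set.mem_inter_iff, mem_neighborSet, Set.mem_ofPred_eq, Set.mem_sdiff,
        Set.mem_singleton_iff]
      refine and_congr_right fun hx ↦ ⟨?_, fun hxp ↦ ?_⟩
      · rintro ⟨h, -⟩ rfl
        omega
      · have hdx : G.dist v x = G.dist v w + 1 :=
          (hG.dist_eq_dist_add_one_of_adj v hx).resolve_left fun h ↦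
            hxp (hG.eq_of_adj_of_dist_eq hx hp h hdp)
        have e₁ := hG.dist_eq_of_adj_of_ne h₁ hx hvw hdx (by omega)
        have e₂ := hG.dist_eq_of_adj_of_ne h₂ hx hvw hdx (by omega)
        omega
    rw [this, Set.ncard_sdiff_singleton_of_mem (by exact hp), hreg]
    rfl

lemma ncard_parents_branchSphere (hG : G.IsTree) (h₁ : G.Adj v v₁) (h₂ : G.Adj v v₂)
    {k : ℕ} {w : V} (hw : w ∈ G.branchSphere v v₁ v₂ (k + 1)) :
    (G.neighborSet w ∩ G.branchSphere v v₁ v₂ k).ncard = 1 := by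
  obtain ⟨hd, hd₁, hd₂⟩ := hw
  have hvw : v ≠ w := by rintro rfl; simp at hd
  obtain ⟨p, hp, hdp⟩ := hG.connected.exists_adj_dist_eq hvw
  rw [Set.ncard_eq_one]
  refine ⟨p, Set.eq_singleton_iff_unique_mem.2 ⟨⟨hp, by omega, ?_, ?_⟩, fun x hx ↦ ?_⟩⟩
  · have h := hG.connected.dist_triangle (u := v₁) (v := v) (w := p)
    rw [dist_eq_one_iff_adj.2 h₁.symm] at h
    have := hG.dist_eq_dist_add_one_of_adj v₁ hp
    omega
  · have h := hG.connected.dist_triangle (u := v₂) (v := v) (w := p)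
    rw [dist_eq_one_iff_adj.2 h₂.symm] at h
    have := hG.dist_eq_dist_add_one_of_adj v₂ hp
    omega
  · exact hG.eq_of_adj_of_dist_eq hx.1 hp (by rw [hd, hx.2.1]) hdp

lemma finite_branchSphere (hG : G.IsTree) (hreg : ∀ v, (G.neighborSet v).ncard = q + 1)
    (h₁ : G.Adj v v₁) (h₂ : G.Adj v v₂) (k : ℕ) : (G.branchSphere v v₁ v₂ k).Finite := by
  induction k with
  | zero => rw [branchSphere_zero hG h₁ h₂]; exact Set.finite_singleton v
  | succ k ih =>
    refine (ih.biUnion fun w _ ↦ Set.finite_of_ncard_ne_zero (s := G.neighborSet w)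
      (by rw [hreg]; omega)).subset fun w hw ↦ ?_
    have h := ncard_parents_branchSphere hG h₁ h₂ hw
    obtain ⟨x, hx⟩ := Set.nonempty_of_ncard_ne_zero (by rw [h]; exact one_ne_zero)
    exact Set.mem_biUnion hx.2 hx.1.symm

lemma ncard_branchSphere_succ (hG : G.IsTree) (hreg : ∀ v, (G.neighborSet v).ncard = q + 1)
    (h₁ : G.Adj v v₁) (h₂ : G.Adj v v₂) (h₁₂ : v₁ ≠ v₂) (k : ℕ) :
    (G.branchSphere v v₁ v₂ (k + 1)).ncard =
      (G.branchSphere v v₁ v₂ k).ncard * if k = 0 then q - 1 else q := by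
  classical
  have hf := finite_branchSphere hG hreg h₁ h₂
  have h := Finset.card_mul_eq_card_mul (s := (hf k).toFinset) (t := (hf (k + 1)).toFinset) G.Adj
    (m := if k = 0 then q - 1 else q) (n := 1) ?_ ?_
  · rw [Set.ncard_eq_toFinset_card _ (hf k), Set.ncard_eq_toFinset_card _ (hf (k + 1)), h, mul_one]
  · intro w hw
    rw [← ncard_children_branchSphere hG hreg h₁ h₂ h₁₂ ((hf k).mem_toFinset.1 hw),
      ← Set.ncard_coe_finset]
    congr 1
    ext x
    simp [Finset.bipartiteAbove, and_comm]
  · intro w hw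
    rw [← ncard_parents_branchSphere hG h₁ h₂ ((hf (k + 1)).mem_toFinset.1 hw),
      ← Set.ncard_coe_finset]
    congr 1
    ext x
    simp [Finset.bipartiteBelow, and_comm, G.adj_comm]

lemma ncard_branchSphere (hG : G.IsTree) (hreg : ∀ v, (G.neighborSet v).ncard = q + 1)
    (h₁ : G.Adj v v₁) (h₂ : G.Adj v v₂) (h₁₂ : v₁ ≠ v₂) (k : ℕ) :
    (G.branchSphere v v₁ v₂ (k + 1)).ncard = (q - 1) * q ^ k := by
  induction k with
  | zero => simp [ncard_branchSphere_succ hG hreg h₁ h₂ h₁₂ 0, branchSphere_zero hG h₁ h₂]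
  | succ k ih => rw [ncard_branchSphere_succ hG hreg h₁ h₂ h₁₂, ih, if_neg (by omega), pow_succ,
      mul_assoc]

lemma branchBall_zero : G.branchBall v v₁ v₂ 0 = G.branchSphere v v₁ v₂ 0 := by
  ext w
  simp only [branchBall, branchSphere, Set.mem_ofPred_eq]
  omega

lemma finite_branchBall (hG : G.IsTree) (hreg : ∀ v, (G.neighborSet v).ncard = q + 1)
    (h₁ : G.Adj v v₁) (h₂ : G.Adj v v₂) (k : ℕ) : (G.branchBall v v₁ v₂ k).Finite := by
  induction k with
  | zero => rw [branchBall_zero]; exact finite_branchSphere hG hreg h₁ h₂ 0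
  | succ k ih => rw [branchBall_succ]; exact ih.union (finite_branchSphere hG hreg h₁ h₂ _)

lemma ncard_branchBall (hG : G.IsTree) (hq : 1 ≤ q) (hreg : ∀ v, (G.neighborSet v).ncard = q + 1)
    (h₁ : G.Adj v v₁) (h₂ : G.Adj v v₂) (h₁₂ : v₁ ≠ v₂) (k : ℕ) :
    (G.branchBall v v₁ v₂ k).ncard = q ^ k := by
  induction k with
  | zero => simp [branchBall_zero, branchSphere_zero hG h₁ h₂]
  | succ k ih =>
    rw [branchBall_succ, Set.ncard_union_eq (disjoint_branchBall_branchSphere k)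
      (finite_branchBall hG hreg h₁ h₂ k) (finite_branchSphere hG hreg h₁ h₂ _), ih,
      ncard_branchSphere hG hreg h₁ h₂ h₁₂]
    obtain ⟨p, rfl⟩ := Nat.exists_eq_add_of_le hq
    rw [Nat.add_sub_cancel_left]
    ring

namespace IsGeodesicLine

variable {γ γ' : ℤ → V}

lemma sInf_dist_le_iff {w : V} {k : ℕ} :
    sInf ((fun u ↦ G.dist w u) '' Set.range γ) ≤ k ↔ ∃ m, G.dist w (γ m) ≤ k := by
  constructor
  · intro h
    obtain ⟨_, ⟨m, rfl⟩, hm⟩ := Nat.sInf_mem ((Set.range_nonempty γ).image fun u ↦ G.dist w u)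
    exact ⟨m, hm.trans_le h⟩
  · rintro ⟨m, hm⟩
    exact (Nat.sInf_le (Set.mem_image_of_mem _ (Set.mem_range_self m))).trans hm

lemma mem_branchBall_iff (hG : G.IsTree) (hγ : G.IsGeodesicLine γ) {n : ℤ} {k : ℕ} {w : V} :
    w ∈ G.branchBall (γ n) (γ (n + 1)) (γ (n - 1)) k ↔
      G.dist w (γ n) ≤ k ∧ ∀ m, G.dist w (γ m) = G.dist w (γ n) + (m - n).natAbs := by
  simp only [branchBall, Set.mem_ofPred_eq, G.dist_comm (v := w)]
  refine and_congr_right fun _ ↦ ⟨fun h ↦ hγ.dist_eq_add hG h.1 h.2, fun h ↦ ⟨?_, ?_⟩⟩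
  · rw [h (n + 1)]; omega
  · rw [h (n - 1)]; omega

lemma finite_branchBall (hG : G.IsTree) (hreg : ∀ v, (G.neighborSet v).ncard = q + 1)
    (hγ : G.IsGeodesicLine γ) (n : ℤ) (k : ℕ) :
    (G.branchBall (γ n) (γ (n + 1)) (γ (n - 1)) k).Finite := by
  have h := hγ.adj (n - 1)
  rw [sub_add_cancel] at h
  exact SimpleGraph.finite_branchBall hG hreg (hγ.adj n) h.symm k

lemma ncard_branchBall (hG : G.IsTree) (hq : 1 ≤ q) (hreg : ∀ v, (G.neighborSet v).ncard = q + 1)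
    (hγ : G.IsGeodesicLine γ) (n : ℤ) (k : ℕ) :
    (G.branchBall (γ n) (γ (n + 1)) (γ (n - 1)) k).ncard = q ^ k := by
  have h := hγ.adj (n - 1)
  rw [sub_add_cancel] at h
  exact SimpleGraph.ncard_branchBall hG hq hreg (hγ.adj n) h.symm
    (fun h ↦ by have := hγ.injective h; omega) k

/-- Suppose `γ` leaves `γ'` in the step from `γ b` to `γ b'`. Then the geodesics to `γ'` from
vertices projecting to `γ n` beyond `b'` pass through `γ b`. -/
lemma exists_dist_le_iff (hG : G.IsTree) (hγ : G.IsGeodesicLine γ) (hγ' : G.IsGeodesicLine γ')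
    {n b b' : ℤ} {w : V} (hw : ∀ m, G.dist w (γ m) = G.dist w (γ n) + (m - n).natAbs)
    (hb : γ b ∈ Set.range γ') (hb' : γ b' ∉ Set.range γ') (hbb' : (b - b').natAbs = 1)
    (hn : (b - n).natAbs = (b' - n).natAbs + 1) (k : ℕ) :
    (∃ m, G.dist w (γ' m) ≤ k) ↔ G.dist w (γ n) + (b - n).natAbs ≤ k := by
  obtain ⟨c, hc⟩ := hb
  have key := hγ'.dist_eq_add_of_adj_notMem hG (u := w) (y := γ b') (c := c)
    (by rw [hc, ← dist_eq_one_iff_adj, hγ.dist_eq, hbb']) (by rw [hc, hw b, hw b']; omega) hb'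
  rw [hc, hw b] at key
  constructor
  · rintro ⟨m, hm⟩
    rw [key m] at hm
    omega
  · exact fun h ↦ ⟨c, by rw [key c]; omega⟩

lemma exists_inter_eq_Icc (hG : G.IsTree) (hγ : G.IsGeodesicLine γ) (hγ' : G.IsGeodesicLine γ')
    (hfin : (Set.range γ ∩ Set.range γ').Finite)
    (hne : (Set.range γ ∩ Set.range γ').Nonempty) :
    ∃ a b : ℤ, a ≤ b ∧ (∀ n, γ n ∈ Set.range γ' ↔ a ≤ n ∧ n ≤ b) ∧
      ((Set.range γ ∩ Set.range γ').ncard : ℤ) = b - a + 1 := by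
  have hI : (γ ⁻¹' Set.range γ').Finite :=
    (hfin.preimage hγ.injective.injOn).subset fun n hn ↦ ⟨⟨n, rfl⟩, hn⟩
  have hI' : (γ ⁻¹' Set.range γ').Nonempty := by
    obtain ⟨_, ⟨n, rfl⟩, hn⟩ := hne
    exact ⟨n, hn⟩
  obtain ⟨a, ha, ha'⟩ := Set.exists_min_image _ id hI hI'
  obtain ⟨b, hb, hb'⟩ := Set.exists_max_image _ id hI hI'
  have hab : a ≤ b := ha' b hb
  have hiff : ∀ n, γ n ∈ Set.range γ' ↔ a ≤ n ∧ n ≤ b := by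
    refine fun n ↦ ⟨fun h ↦ ⟨ha' n h, hb' n h⟩, fun ⟨h₁, h₂⟩ ↦ ?_⟩
    by_contra hn
    have han : a ≠ n := by rintro rfl; exact hn ha
    obtain ⟨c, ⟨hc, hcn⟩, hc'⟩ := Set.exists_max_image (γ ⁻¹' Set.range γ' ∩ Set.Iio n) id
      (hI.inter_of_left _) ⟨a, ha, lt_of_le_of_ne h₁ han⟩
    have hcn' : c < n := hcn
    have hc₁ : γ (c + 1) ∉ Set.range γ' := by
      intro h
      rcases eq_or_ne (c + 1) n with rfl | h'
      · exact hn h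
      · have : c + 1 ≤ c := hc' (c + 1) ⟨h, by simp only [Set.mem_Iio]; omega⟩
        omega
    have := (hγ.exists_dist_le_iff hG hγ' (n := b) (w := γ b)
      (fun m ↦ by rw [hγ.dist_eq, hγ.dist_eq]; omega) hc hc₁ (by omega) (by omega) 0).1
      (by obtain ⟨m, hm⟩ := hb; exact ⟨m, by simp [hm]⟩)
    omega
  refine ⟨a, b, hab, hiff, ?_⟩
  have : Set.range γ ∩ Set.range γ' = γ '' (Finset.Icc a b : Finset ℤ) := by
    ext x
    constructor
    · rintro ⟨⟨n, rfl⟩, hn⟩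
      exact ⟨n, by simpa using (hiff n).1 hn, rfl⟩
    · rintro ⟨n, hn, rfl⟩
      exact ⟨⟨n, rfl⟩, (hiff n).2 (by simpa using hn)⟩
  rw [this, Set.ncard_image_of_injective _ hγ.injective, Set.ncard_coe_finset, Int.card_Icc]
  omega

lemma tube_inter_eq_biUnion (hG : G.IsTree) (hγ : G.IsGeodesicLine γ)
    (hγ' : G.IsGeodesicLine γ') {a b : ℤ} (hab : a ≤ b)
    (hI : ∀ n, γ n ∈ Set.range γ' ↔ a ≤ n ∧ n ≤ b) {α β : ℕ} (hαβ : α ≤ β) :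
    {w | (∃ m, G.dist w (γ m) ≤ α) ∧ ∃ m, G.dist w (γ' m) ≤ β} =
      ⋃ n ∈ Finset.Icc (a - β) (b + β), G.branchBall (γ n) (γ (n + 1)) (γ (n - 1))
        (min α (β - (max (a - n) (n - b)).toNat)) := by
  ext w
  simp only [Set.mem_ofPred_eq, Set.mem_iUnion, hγ.mem_branchBall_iff hG, Finset.mem_Icc,
    exists_prop]
  have key : ∀ n, (∀ m, G.dist w (γ m) = G.dist w (γ n) + (m - n).natAbs) →
      (((∃ m, G.dist w (γ m) ≤ α) ∧ ∃ m, G.dist w (γ' m) ≤ β) ↔ (a - β ≤ n ∧ n ≤ b + β) ∧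
        G.dist w (γ n) ≤ min α (β - (max (a - n) (n - b)).toNat)) := by
    intro n hn
    have hA : (∃ m, G.dist w (γ m) ≤ α) ↔ G.dist w (γ n) ≤ α :=
      ⟨fun ⟨m, hm⟩ ↦ by rw [hn m] at hm; omega, fun h ↦ ⟨n, h⟩⟩
    rw [hA]
    rcases lt_or_ge n a with h | h
    · rw [hγ.exists_dist_le_iff hG hγ' hn ((hI a).2 ⟨le_rfl, hab⟩)
        (b' := a - 1) (fun h ↦ by have := (hI _).1 h; omega) (by omega) (by omega)]
      omega
    rcases lt_or_ge b n with h' | h'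
    · rw [hγ.exists_dist_le_iff hG hγ' hn ((hI b).2 ⟨hab, le_rfl⟩)
        (b' := b + 1) (fun h ↦ by have := (hI _).1 h; omega) (by omega) (by omega)]
      omega
    · obtain ⟨m, hm⟩ := (hI n).2 ⟨h, h'⟩
      have : G.dist w (γ n) ≤ α → ∃ m, G.dist w (γ' m) ≤ β := fun h ↦ ⟨m, by rw [hm]; omega⟩
      rw [and_iff_left_of_imp this]
      omega
  constructor
  · intro h
    obtain ⟨n, hn⟩ := hγ.exists_dist_eq_add hG w
    obtain ⟨h₁, h₂⟩ := (key n hn).1 h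
    exact ⟨n, h₁, h₂, hn⟩
  · rintro ⟨n, h₁, h₂, hn⟩
    exact (key n hn).2 ⟨h₁, h₂⟩

lemma ncard_tube_inter (hG : G.IsTree) (hq : 1 ≤ q)
    (hreg : ∀ v, (G.neighborSet v).ncard = q + 1) (hγ : G.IsGeodesicLine γ)
    (hγ' : G.IsGeodesicLine γ') {a b : ℤ} (hab : a ≤ b)
    (hI : ∀ n, γ n ∈ Set.range γ' ↔ a ≤ n ∧ n ≤ b) {α β : ℕ} (hαβ : α ≤ β) :
    {w | (∃ m, G.dist w (γ m) ≤ α) ∧ ∃ m, G.dist w (γ' m) ≤ β}.ncard =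
      ∑ n ∈ Finset.Icc (a - β) (b + β), q ^ min α (β - (max (a - n) (n - b)).toNat) := by
  classical
  have hf := hγ.finite_branchBall hG hreg
  let k : ℤ → ℕ := fun n ↦ min α (β - (max (a - n) (n - b)).toNat)
  have hT : {w | (∃ m, G.dist w (γ m) ≤ α) ∧ ∃ m, G.dist w (γ' m) ≤ β} =
      ((Finset.Icc (a - β) (b + β)).biUnion fun n ↦ (hf n (k n)).toFinset : Finset V) := by
    rw [hγ.tube_inter_eq_biUnion hG hγ' hab hI hαβ]
    simp [k]
  rw [hT, Set.ncard_coe_finset, Finset.card_biUnion]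
  · refine Finset.sum_congr rfl fun n _ ↦ ?_
    rw [← Set.ncard_eq_toFinset_card _ (hf n (k n)), hγ.ncard_branchBall hG hq hreg]
  · intro n _ n' _ hnn'
    rw [Function.onFun, Finset.disjoint_left]
    intro w hw hw'
    rw [Set.Finite.mem_toFinset, hγ.mem_branchBall_iff hG] at hw hw'
    have h₁ := hw.2 n'
    have h₂ := hw'.2 n
    omega

end IsGeodesicLine

end SimpleGraph

lemma sum_range_pow_min (q : ℕ) {α β : ℕ} (hαβ : α ≤ β) :
    ∑ i ∈ Finset.range β, q ^ min α i =
      ∑ i ∈ Finset.range α, q ^ i + (β - α) * q ^ α := by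
  obtain ⟨d, rfl⟩ := Nat.exists_eq_add_of_le hαβ
  rw [Finset.sum_range_add, Nat.add_sub_cancel_left]
  congr 1
  · exact Finset.sum_congr rfl fun i hi ↦ by rw [min_eq_right (Finset.mem_range.1 hi).le]
  · simp

lemma sum_Icc_pow_min (q : ℕ) {a b : ℤ} (hab : a ≤ b) {α β : ℕ} (hαβ : α ≤ β) :
    ∑ n ∈ Finset.Icc (a - β) (b + β), q ^ min α (β - (max (a - n) (n - b)).toNat) =
      (b - a + 1).toNat * q ^ α +
        2 * (∑ i ∈ Finset.range α, q ^ i + (β - α) * q ^ α) := by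
  have hsplit : Finset.Icc (a - β) (b + β) =
      (Finset.Ico (a - β) a).disjUnion ((Finset.Icc a b).disjUnion (Finset.Ioc b (b + β))
        (by rw [Finset.disjoint_left]; intro x; simp; omega))
        (by rw [Finset.disjoint_left]; intro x; simp; omega) := by
    ext x
    simp only [Finset.mem_disjUnion, Finset.mem_Icc, Finset.mem_Ico, Finset.mem_Ioc]
    omega
  have hmid : ∑ n ∈ Finset.Icc a b, q ^ min α (β - (max (a - n) (n - b)).toNat) =
      (b - a + 1).toNat * q ^ α := by
    rw [Finset.sum_congr rfl fun n hn ↦ ?_, Finset.sum_const, Int.card_Icc, smul_eq_mul]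
    · congr 2; omega
    · rw [Finset.mem_Icc] at hn
      congr 1
      omega
  have hleft : ∑ n ∈ Finset.Ico (a - β) a, q ^ min α (β - (max (a - n) (n - b)).toNat) =
      ∑ i ∈ Finset.range β, q ^ min α i := by
    refine Finset.sum_bij' (fun n _ ↦ (n - (a - β)).toNat) (fun i _ ↦ a - β + i) ?_ ?_ ?_ ?_ ?_
    all_goals intro n hn; simp only [Finset.mem_Ico, Finset.mem_range] at hn ⊢
    any_goals omega
    congr 1
    omega
  have hright : ∑ n ∈ Finset.Ioc b (b + β), q ^ min α (β - (max (a - n) (n - b)).toNat) =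
      ∑ i ∈ Finset.range β, q ^ min α i := by
    refine Finset.sum_bij' (fun n _ ↦ (b + β - n).toNat) (fun i _ ↦ b + β - i) ?_ ?_ ?_ ?_ ?_
    all_goals intro n hn; simp only [Finset.mem_Ioc, Finset.mem_range] at hn ⊢
    any_goals omega
    congr 1
    omega
  rw [hsplit, Finset.sum_disjUnion, Finset.sum_disjUnion, hmid, hleft, hright,
    sum_range_pow_min q hαβ]
  ring

lemma SimpleGraph.IsGeodesicLine.cast_ncard_tube_inter {V : Type*} {G : SimpleGraph V}
    (hG : G.IsTree) {q : ℕ} (hq : 2 ≤ q) (hreg : ∀ v, (G.neighborSet v).ncard = q + 1)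
    {γ γ' : ℤ → V} (hγ : G.IsGeodesicLine γ) (hγ' : G.IsGeodesicLine γ')
    (hfin : (Set.range γ ∩ Set.range γ').Finite)
    (hne : (Set.range γ ∩ Set.range γ').Nonempty) {α β : ℕ} (hαβ : α ≤ β) :
    ({w | (∃ m, G.dist w (γ m) ≤ α) ∧ ∃ m, G.dist w (γ' m) ≤ β}.ncard : ℚ) =
      ((Set.range γ ∩ Set.range γ').ncard + 2 * ((β - α : ℕ) : ℚ)) * (q : ℚ) ^ α +
        2 * ((q : ℚ) ^ α - 1) / ((q : ℚ) - 1) := by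
  obtain ⟨a, b, hab, hI, hr⟩ := hγ.exists_inter_eq_Icc hG hγ' hfin hne
  rw [hγ.ncard_tube_inter hG (by omega) hreg hγ' hab hI hαβ, sum_Icc_pow_min q hab hαβ, ← hr,
    Int.toNat_natCast]
  have hq₁ : (q : ℚ) ≠ 1 := by exact_mod_cast (by omega : q ≠ 1)
  have hgeom := geom_sum_eq hq₁ α
  push_cast
  rw [hgeom]
  ring


/-- Count of vertices in the intersection of the tubes `T_α(A)` and `T_β(B)` around
two distinct apartments whose intersection is finite and nonempty with `r` vertices:
`(r + 2|α−β|)·q^{min(α,β)} + 2·(q^{min(α,β)} − 1)/(q−1)`. -/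
theorem stmt_9 {V : Type*} (G : SimpleGraph V) (hG : G.IsTree) [Infinite V]
    (q : ℕ) (hq : 2 ≤ q)
    (hreg : ∀ v : V, (G.neighborSet v).ncard = q + 1)
    (γA γB : ℤ → V)
    (hadjA : ∀ n : ℤ, G.Adj (γA n) (γA (n + 1)))
    (hgeoA : ∀ m n : ℤ, G.dist (γA m) (γA n) = (m - n).natAbs)
    (hadjB : ∀ n : ℤ, G.Adj (γB n) (γB (n + 1)))
    (hgeoB : ∀ m n : ℤ, G.dist (γB m) (γB n) = (m - n).natAbs)
    (hne : Set.range γA ≠ Set.range γB)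
    (hfin : (Set.range γA ∩ Set.range γB).Finite)
    (hnonempty : (Set.range γA ∩ Set.range γB).Nonempty)
    (r : ℕ) (hr : (Set.range γA ∩ Set.range γB).ncard = r) (hr1 : 1 ≤ r)
    (α β : ℕ) :
    ({w : V | sInf ((fun u => G.dist w u) '' Set.range γA) ≤ α ∧
        sInf ((fun u => G.dist w u) '' Set.range γB) ≤ β}.ncard : ℚ)
      = ((r : ℚ) + 2 * ((((α : ℤ) - β).natAbs : ℚ))) * (q : ℚ) ^ (min α β)
        + 2 * ((q : ℚ) ^ (min α β) - 1) / ((q : ℚ) - 1) := by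
  have hA : G.IsGeodesicLine γA := ⟨hadjA, hgeoA⟩
  have hB : G.IsGeodesicLine γB := ⟨hadjB, hgeoB⟩
  simp only [SimpleGraph.IsGeodesicLine.sInf_dist_le_iff]
  subst hr
  rcases le_total α β with h | h
  · rw [hA.cast_ncard_tube_inter hG hq hreg hB hfin hnonempty h, min_eq_left h,
      show ((α : ℤ) - β).natAbs = β - α by omega]
  · rw [Set.inter_comm] at hfin hnonempty ⊢
    simp only [and_comm (a := ∃ m, G.dist _ (γA m) ≤ α)]
    rw [hB.cast_ncard_tube_inter hG hq hreg hA hfin hnonempty h, min_eq_right h,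
      show ((α : ℤ) - β).natAbs = α - β by omega]
end
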